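/- For every integer m ≥ 3, the ideal of 2×2 minors of the generic m×3 matrix is of fiber type. -/

import Mathlib

open MvPolynomial

/-- Index set for the 2×2 minors of a generic `m × n` matrix:
quadruples `((i,i'),(j,j'))` with `i < i'` and `j < j'`. -/
def MinorIdx (m n : ℕ) : Type :=
  {w : (Fin m × Fin m) × (Fin n × Fin n) // w.1.1 < w.1.2 ∧ w.2.1 < w.2.2}

/-- The 2×2 minor `Δ_{(i,i'),(j,j')} = x_{i,j} x_{i',j'} - x_{i,j'} x_{i',j}`. -/
noncomputable def minorΔ {m n : ℕ} (w : MinorIdx m n) : MvPolynomial (Fin m × Fin n) ℂ :=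
  X (w.1.1.1, w.1.2.1) * X (w.1.1.2, w.1.2.2) - X (w.1.1.1, w.1.2.2) * X (w.1.1.2, w.1.2.1)

/-- The `S`-algebra map `Π : T = S[y_w] → S[t]` with `Π(y_w) = t·Δ_w`. -/
noncomputable def Pihom (m n : ℕ) :
    MvPolynomial (MinorIdx m n) (MvPolynomial (Fin m × Fin n) ℂ) →ₐ[MvPolynomial (Fin m × Fin n) ℂ]
      Polynomial (MvPolynomial (Fin m × Fin n) ℂ) :=
  aeval fun w => Polynomial.C (minorΔ w) * Polynomial.X

/-- The ideal of 2×2 minors of the generic `m × n` matrix is of *fiber type* if the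
defining ideal `𝒥 = ker Π` of the Rees algebra is generated by `𝒥 ∩ ℂ[y_w : w]`
together with the elements of `𝒥` homogeneous of degree 1 in the `y_w`. -/
def FiberType (m n : ℕ) : Prop :=
  RingHom.ker (Pihom m n) =
    Ideal.span
      ({f | f ∈ RingHom.ker (Pihom m n) ∧
          f ∈ Set.range (MvPolynomial.map
            (algebraMap ℂ (MvPolynomial (Fin m × Fin n) ℂ))
              (σ := MinorIdx m n))} ∪
        {f | f ∈ RingHom.ker (Pihom m n) ∧ f.IsHomogeneous 1})


set_option linter.all false
namespace FT
noncomputable section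

/-- generators `x_i^α` and `y_ij^γ` -/
abbrev Gn (m : ℕ) : Type := (Fin m × Fin 3) ⊕ (Fin m × Fin m × Fin 3)
abbrev AA (m : ℕ) : Type := MvPolynomial (Gn m) ℂ
abbrev SS (m : ℕ) : Type := MvPolynomial (Fin m × Fin 3) ℂ

variable {m : ℕ}

def xx (i : Fin m) (a : Fin 3) : AA m := X (Sum.inl (i, a))
def yy (i j : Fin m) (a : Fin 3) : AA m := X (Sum.inr (i, j, a))
def sx (i : Fin m) (a : Fin 3) : SS m := X (i, a)

/-- cross product, cyclically indexed -/
def cr {R : Type*} [Ring R] (u v : Fin 3 → R) (a : Fin 3) : R :=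
  u (a + 1) * v (a + 2) - u (a + 2) * v (a + 1)

/-- Kronecker delta -/
def dl {ι : Type*} [DecidableEq ι] (a b : ι) : ℂ := if a = b then 1 else 0

/-- Levi-Civita symbol -/
def ep (a b c : Fin 3) : ℂ :=
  if b = a + 1 ∧ c = a + 2 then 1 else if b = a + 2 ∧ c = a + 1 then -1 else 0

def Del (i j : Fin m) (a : Fin 3) : AA m := cr (xx i) (xx j) a

/-- build a derivation of `A` from its values on generators -/
def der (fx : Fin m → Fin 3 → AA m) (fy : Fin m → Fin m → Fin 3 → AA m) :
    Derivation ℂ (AA m) (AA m) :=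
  mkDerivation ℂ (Sum.elim (fun p => fx p.1 p.2) (fun p => fy p.1 p.2.1 p.2.2))

@[simp] lemma der_xx (fx : Fin m → Fin 3 → AA m) (fy : Fin m → Fin m → Fin 3 → AA m)
    (i : Fin m) (a : Fin 3) : der fx fy (xx i a) = fx i a := by
  simp [der, xx, mkDerivation_X]

@[simp] lemma der_yy (fx : Fin m → Fin 3 → AA m) (fy : Fin m → Fin m → Fin 3 → AA m)
    (i j : Fin m) (a : Fin 3) : der fx fy (yy i j a) = fy i j a := by
  simp [der, yy, mkDerivation_X]

/-- derivations agree if they agree on generators -/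
lemma der_ext {P Q : Derivation ℂ (AA m) (AA m)} (hx : ∀ i a, P (xx i a) = Q (xx i a))
    (hy : ∀ i j a, P (yy i j a) = Q (yy i j a)) : P = Q := by
  apply MvPolynomial.derivation_ext
  rintro (⟨i, a⟩ | ⟨i, j, a⟩)
  · exact hx i a
  · exact hy i j a

def phi : AA m →ₐ[ℂ] SS m :=
  aeval (Sum.elim (fun p => sx p.1 p.2) (fun p => cr (sx p.1) (sx p.2.1) p.2.2))

@[simp] lemma phi_xx (i : Fin m) (a : Fin 3) : phi (xx i a) = sx i a := by
  simp [phi, xx]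
@[simp] lemma phi_yy (i j : Fin m) (a : Fin 3) :
    phi (yy i j a) = cr (sx i) (sx j) a := by
  simp [phi, yy]
@[simp] lemma phi_Del (i j : Fin m) (a : Fin 3) :
    phi (Del i j a) = cr (sx i) (sx j) a := by
  simp [Del, cr]

/-- induction principle: two `φ`-derivation-like additive maps agree -/
lemma phi_der_ext (P Q : AA m →ₗ[ℂ] SS m)
    (hP : ∀ a b, P (a * b) = phi a * P b + phi b * P a)
    (hQ : ∀ a b, Q (a * b) = phi a * Q b + phi b * Q a)
    (hx : ∀ i a, P (xx i a) = Q (xx i a))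
    (hy : ∀ i j a, P (yy i j a) = Q (yy i j a)) (f : AA m) : P f = Q f := by
  have h1 : ∀ (R : AA m →ₗ[ℂ] SS m), (∀ a b, R (a * b) = phi a * R b + phi b * R a) → R 1 = 0 := by
    intro R hR
    have := hR 1 1
    simpa using this
  induction f using MvPolynomial.induction_on with
  | C c =>
    have : (C c : AA m) = c • (1 : AA m) := by simp [MvPolynomial.smul_eq_C_mul]
    rw [this, map_smul, map_smul, h1 P hP, h1 Q hQ]
  | add p q hp hq => simp [hp, hq]
  | mul_X p g hp =>
    rw [hP, hQ, hp]
    congr 2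
    rcases g with ⟨i, a⟩ | ⟨i, j, a⟩
    · exact hx i a
    · exact hy i j a

/-- intertwining of derivations through `φ`, checked on generators -/
lemma phi_int (P : Derivation ℂ (AA m) (AA m)) (Q : Derivation ℂ (SS m) (SS m))
    (hx : ∀ i a, phi (P (xx i a)) = Q (sx i a))
    (hy : ∀ i j a, phi (P (yy i j a)) = Q (cr (sx i) (sx j) a)) (f : AA m) :
    phi (P f) = Q (phi f) := by
  refine phi_der_ext (phi.toLinearMap ∘ₗ P.toLinearMap) (Q.toLinearMap ∘ₗ phi.toLinearMap)
    ?_ ?_ ?_ ?_ f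
  · intro a b; simp
  · intro a b; simp
  · intro i a; simpa using hx i a
  · intro i j a; simpa using hy i j a

/-- two derivations of `A` agree after `φ`, checked on generators -/
lemma phi_int2 (P Q : Derivation ℂ (AA m) (AA m))
    (hx : ∀ i a, phi (P (xx i a)) = phi (Q (xx i a)))
    (hy : ∀ i j a, phi (P (yy i j a)) = phi (Q (yy i j a))) (f : AA m) :
    phi (P f) = phi (Q f) := by
  refine phi_der_ext (phi.toLinearMap ∘ₗ P.toLinearMap) (phi.toLinearMap ∘ₗ Q.toLinearMap)
    ?_ ?_ ?_ ?_ f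
  · intro a b; simp
  · intro a b; simp
  · intro i a; simpa using hx i a
  · intro i j a; simpa using hy i j a

/-! ### The derivations -/

def EY : Derivation ℂ (AA m) (AA m) := der (fun _ _ => 0) (fun i j a => yy i j a)
def EX : Derivation ℂ (AA m) (AA m) := der (fun i a => xx i a) (fun _ _ _ => 0)
def NN : Derivation ℂ (AA m) (AA m) := EY + EX

def EE (a b : Fin 3) : Derivation ℂ (AA m) (AA m) :=
  der (fun i c => dl b c • xx i a) (fun i j c => dl a b • yy i j c - dl a c • yy i j b)

def Sder (fx : Fin m → Fin 3 → SS m) : Derivation ℂ (SS m) (SS m) :=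
  mkDerivation ℂ (fun p => fx p.1 p.2)
@[simp] lemma Sder_sx (fx : Fin m → Fin 3 → SS m) (i : Fin m) (a : Fin 3) :
    Sder fx (sx i a) = fx i a := by
  simp [Sder, sx, mkDerivation_X]

lemma Sder_ext {P Q : Derivation ℂ (SS m) (SS m)} (hx : ∀ i a, P (sx i a) = Q (sx i a)) :
    P = Q := by
  apply MvPolynomial.derivation_ext
  rintro ⟨i, a⟩
  exact hx i a

def ES (a b : Fin 3) : Derivation ℂ (SS m) (SS m) := Sder (fun i c => dl b c • sx i a)
def dS (i : Fin m) (u : Fin 3) : Derivation ℂ (SS m) (SS m) :=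
  Sder (fun j c => algebraMap ℂ _ (dl i j * dl u c))

/-- `∂/∂x_{iμ}` -/
def dX (i : Fin m) (u : Fin 3) : Derivation ℂ (AA m) (AA m) :=
  der (fun j c => algebraMap ℂ _ (dl i j * dl u c)) (fun _ _ _ => 0)
/-- `∂/∂y_{ib}^γ - ∂/∂y_{bi}^γ` -/
def dY (i b : Fin m) (g : Fin 3) : Derivation ℂ (AA m) (AA m) :=
  der (fun _ _ => 0)
    (fun e f c => algebraMap ℂ _ (dl g c * (dl i e * dl b f - dl i f * dl b e)))
/-- `(e_μ × v)^γ` -/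
def em (u : Fin 3) (v : Fin 3 → AA m) (g : Fin 3) : AA m :=
  ∑ r, ep g u r • v r
def DD (i : Fin m) (u : Fin 3) : Derivation ℂ (AA m) (AA m) :=
  der (fun _ _ => 0) (fun e f c => dl i e • em u (xx f) c - dl i f • em u (xx e) c)
def UU : Derivation ℂ (AA m) (AA m) := der (fun _ _ => 0) (fun i j a => Del i j a)
/-- lift of `[abd] r_c` -/
def ZZ (a b d c : Fin m) (s : Fin 3) : AA m :=
  (1 / 2 : ℂ) • (cr (yy a b) (yy c d) s + cr (yy a c) (yy b d) s + cr (yy a d) (yy b c) s)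
def VV (al : Fin 3) (b d : Fin m) (s : Fin 3) : Derivation ℂ (AA m) (AA m) :=
  der (fun e h => (∑ k, ep h al k • yy b e k) * xx d s) (fun e f h => -(dl al h • ZZ e f b d s))

@[simp] lemma EY_xx (i : Fin m) (a) : EY (xx i a) = 0 := by simp [EY]
@[simp] lemma EY_yy (i j : Fin m) (a) : EY (yy i j a) = yy i j a := by simp [EY]
@[simp] lemma EX_xx (i : Fin m) (a) : EX (xx i a) = xx i a := by simp [EX]
@[simp] lemma EX_yy (i j : Fin m) (a) : EX (yy i j a) = 0 := by simp [EX]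
@[simp] lemma NN_xx (i : Fin m) (a) : NN (xx i a) = xx i a := by simp [NN]
@[simp] lemma NN_yy (i j : Fin m) (a) : NN (yy i j a) = yy i j a := by simp [NN]
@[simp] lemma EE_xx (a b c : Fin 3) (i : Fin m) : EE a b (xx i c) = dl b c • xx i a := by
  simp [EE]
@[simp] lemma EE_yy (a b c : Fin 3) (i j : Fin m) :
    EE a b (yy i j c) = dl a b • yy i j c - dl a c • yy i j b := by simp [EE]
@[simp] lemma dX_xx (i j : Fin m) (u c) :
    dX i u (xx j c) = algebraMap ℂ _ (dl i j * dl u c) := by simp only [dX, der_xx]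
@[simp] lemma dX_yy (i j k : Fin m) (u c) : dX i u (yy j k c) = 0 := by simp only [dX, der_yy]
@[simp] lemma dY_xx (i b j : Fin m) (g c) : dY i b g (xx j c) = 0 := by simp only [dY, der_xx]
@[simp] lemma dY_yy (i b e f : Fin m) (g c) : dY i b g (yy e f c) =
    algebraMap ℂ _ (dl g c * (dl i e * dl b f - dl i f * dl b e)) := by simp only [dY, der_yy]
@[simp] lemma DD_xx (i j : Fin m) (u c) : DD i u (xx j c) = 0 := by simp only [DD, der_xx]
@[simp] lemma DD_yy (i e f : Fin m) (u c) :
    DD i u (yy e f c) = dl i e • em u (xx f) c - dl i f • em u (xx e) c := by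
  simp only [DD, der_yy]
@[simp] lemma UU_xx (i : Fin m) (a) : UU (xx i a) = 0 := by simp [UU]
@[simp] lemma UU_yy (i j : Fin m) (a) : UU (yy i j a) = Del i j a := by simp [UU]
@[simp] lemma VV_xx (al) (b d : Fin m) (s) (e : Fin m) (h) :
    VV al b d s (xx e h) = (∑ k, ep h al k • yy b e k) * xx d s := by simp only [VV, der_xx]
@[simp] lemma VV_yy (al) (b d : Fin m) (s) (e f : Fin m) (h) :
    VV al b d s (yy e f h) = -(dl al h • ZZ e f b d s) := by simp only [VV, der_yy]
@[simp] lemma ES_sx (a b c : Fin 3) (i : Fin m) : ES a b (sx i c) = dl b c • sx i a := by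
  simp [ES]
@[simp] lemma dS_sx (i j : Fin m) (u c) :
    dS i u (sx j c) = algebraMap ℂ _ (dl i j * dl u c) := by simp only [dS, Sder_sx]

/-! ### Intertwining -/

lemma phi_EE (a b : Fin 3) (f : AA m) : phi (EE a b f) = ES a b (phi f) := by
  apply phi_int
  · intro i c; simp
  · intro i j c
    simp only [EE_yy, map_sub, map_smul, phi_yy, cr, Derivation.leibniz, ES_sx, smul_eq_mul]
    fin_cases a <;> fin_cases b <;> fin_cases c <;> simp [dl] <;> ring

lemma phi_DX (i : Fin m) (u : Fin 3) (f : AA m) :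
    phi (DD i u f) + phi (dX i u f) = dS i u (phi f) := by
  rw [← map_add, ← Derivation.add_apply]
  apply phi_int
  · intro i c; simp
  · intro e f c
    simp only [Derivation.add_apply, DD_yy, dX_yy, map_sub, map_add, map_zero, map_smul,
      phi_yy, cr, Derivation.leibniz, dS_sx, smul_eq_mul, em, map_sum, phi_xx, Fin.sum_univ_three,
      map_mul, Algebra.smul_def]
    fin_cases u <;> fin_cases c <;> simp [dl, ep] <;> ring

lemma phi_UU (f : AA m) : phi (UU f) = phi (EY f) := by
  apply phi_int2
  · intro i c; simp
  · intro i c; simp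

lemma phi_ZZ (a b d c : Fin m) (s : Fin 3) : phi (ZZ a b d c s) =
    (∑ r, sx d r * cr (sx a) (sx b) r) * sx c s := by
  have key : phi (cr (yy a b) (yy c d) s + cr (yy a c) (yy b d) s + cr (yy a d) (yy b c) s) =
      (2 : ℂ) • ((∑ r, sx d r * cr (sx a) (sx b) r) * sx c s) := by
    simp only [cr, map_add, map_sub, map_mul, phi_yy, Fin.sum_univ_three, Algebra.smul_def,
      map_ofNat]
    fin_cases s <;> simp <;> ring
  rw [ZZ, map_smul, key, smul_smul]
  norm_num

lemma phi_VV (al : Fin 3) (b d : Fin m) (s : Fin 3) (f : AA m) :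
    phi (VV al b d s f) =
      phi (∑ be, xx b be * xx d s * (EE al be f - dl al be • NN f)) := by
  have := phi_int2 (VV al b d s) (∑ be, (xx b be * xx d s) • (EE al be - dl al be • NN)) ?_ ?_ f
  · rw [this, ← Derivation.coeFnAddMonoidHom_apply, map_sum, Finset.sum_apply]
    simp [Derivation.coeFnAddMonoidHom_apply]
  · intro e h
    rw [VV_xx, ← Derivation.coeFnAddMonoidHom_apply (∑ be, _), map_sum, Finset.sum_apply]
    simp only [Derivation.coeFnAddMonoidHom_apply, Derivation.smul_apply, Derivation.sub_apply,
      EE_xx, NN_xx, smul_eq_mul, Fin.sum_univ_three, map_add, map_mul, map_sub, map_smul,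
      phi_xx, phi_yy, Algebra.smul_def, cr]
    fin_cases al <;> fin_cases h <;> simp [dl, ep] <;> ring
  · intro e f h
    rw [VV_yy, ← Derivation.coeFnAddMonoidHom_apply (∑ be, _), map_sum, Finset.sum_apply]
    simp only [Derivation.coeFnAddMonoidHom_apply, Derivation.smul_apply, Derivation.sub_apply,
      EE_yy, NN_yy, smul_eq_mul, Fin.sum_univ_three, map_add, map_mul, map_sub, map_smul,
      phi_xx, phi_yy, Algebra.smul_def, cr, map_neg, phi_ZZ]
    fin_cases al <;> fin_cases h <;> simp [dl] <;> ring

end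
end FT


namespace FT
noncomputable section
variable {m : ℕ}

/-- multiplication operator -/
def mL (a : AA m) : Module.End ℂ (AA m) := LinearMap.mulLeft ℂ a
@[simp] lemma mL_apply (a f : AA m) : mL a f = a * f := rfl
def op (P : Derivation ℂ (AA m) (AA m)) : Module.End ℂ (AA m) := P.toLinearMap
@[simp] lemma op_apply (P : Derivation ℂ (AA m) (AA m)) (f : AA m) : op P f = P f := rfl

/-- differential operators of order at most `r` -/
def Ord : ℕ → Module.End ℂ (AA m) → Prop
  | 0, D => ∀ a : AA m, D * mL a - mL a * D = 0
  | r + 1, D => ∀ a : AA m, Ord r (D * mL a - mL a * D)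

lemma Ord.zero' (r : ℕ) : Ord r (0 : Module.End ℂ (AA m)) := by
  induction r with
  | zero => intro a; simp
  | succ r ih => intro a; simpa using ih

lemma Ord.succ {r : ℕ} {D : Module.End ℂ (AA m)} (h : Ord r D) : Ord (r + 1) D := by
  induction r generalizing D with
  | zero => intro a; rw [h a]; exact Ord.zero' 0
  | succ r ih => intro a; exact ih (h a)

lemma Ord.mono {r s : ℕ} (hrs : r ≤ s) {D : Module.End ℂ (AA m)} (h : Ord r D) : Ord s D := by
  induction hrs with
  | refl => exact h
  | step _ ih => exact ih.succ

lemma Ord.add {r : ℕ} {D D' : Module.End ℂ (AA m)} (h : Ord r D) (h' : Ord r D') :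
    Ord r (D + D') := by
  induction r generalizing D D' with
  | zero =>
    intro a
    have : (D + D') * mL a - mL a * (D + D') =
      (D * mL a - mL a * D) + (D' * mL a - mL a * D') := by noncomm_ring
    rw [this, h a, h' a, add_zero]
  | succ r ih =>
    intro a
    have : (D + D') * mL a - mL a * (D + D') =
      (D * mL a - mL a * D) + (D' * mL a - mL a * D') := by noncomm_ring
    rw [this]
    exact ih (h a) (h' a)

lemma Ord.smul {r : ℕ} {D : Module.End ℂ (AA m)} (c : ℂ) (h : Ord r D) :
    Ord r (c • D) := by
  induction r generalizing D with
  | zero =>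
    intro a
    have : (c • D) * mL a - mL a * (c • D) = c • (D * mL a - mL a * D) := by
      simp [smul_sub]
    rw [this, h a, smul_zero]
  | succ r ih =>
    intro a
    have : (c • D) * mL a - mL a * (c • D) = c • (D * mL a - mL a * D) := by
      simp [smul_sub]
    rw [this]
    exact ih (h a)

lemma Ord.mul0 {s : ℕ} {D D' : Module.End ℂ (AA m)} (h : Ord 0 D) (h' : Ord s D') :
    Ord s (D * D') := by
  induction s generalizing D' with
  | zero =>
    intro a
    have : (D * D') * mL a - mL a * (D * D') =
      D * (D' * mL a - mL a * D') + (D * mL a - mL a * D) * D' := by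
        simp only [mul_sub, sub_mul, mul_assoc]; abel
    rw [this, h a, h' a]; simp
  | succ s ih =>
    intro a
    have : (D * D') * mL a - mL a * (D * D') =
      D * (D' * mL a - mL a * D') + (D * mL a - mL a * D) * D' := by
        simp only [mul_sub, sub_mul, mul_assoc]; abel
    rw [this, h a, zero_mul, add_zero]
    exact ih (h' a)

lemma Ord.mul {r s : ℕ} {D D' : Module.End ℂ (AA m)} (h : Ord r D) (h' : Ord s D') :
    Ord (r + s) (D * D') := by
  induction r generalizing s D D' with
  | zero => rw [zero_add]; exact h.mul0 h'
  | succ r ih =>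
    induction s generalizing D' with
    | zero =>
      intro a
      have : (D * D') * mL a - mL a * (D * D') =
        D * (D' * mL a - mL a * D') + (D * mL a - mL a * D) * D' := by
        simp only [mul_sub, sub_mul, mul_assoc]; abel
      rw [this, h' a, mul_zero, zero_add]
      exact ih (h a) h'
    | succ s ih2 =>
      intro a
      have : (D * D') * mL a - mL a * (D * D') =
        D * (D' * mL a - mL a * D') + (D * mL a - mL a * D) * D' := by
        simp only [mul_sub, sub_mul, mul_assoc]; abel
      rw [this]
      refine Ord.add (ih2 (h' a)) ?_
      have := ih (h a) h'
      have e : r + (s + 1) = r + 1 + s := by ring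
      rw [e] at this
      exact this

lemma Ord_mL (a : AA m) : Ord 0 (mL a) := by
  intro b
  apply LinearMap.ext
  intro f
  simp [mul_left_comm]

lemma Ord_op (P : Derivation ℂ (AA m) (AA m)) : Ord 1 (op P) := by
  intro a
  have : FT.op P * FT.mL a - FT.mL a * FT.op P = FT.mL (P a) := by
    apply LinearMap.ext
    intro f
    simp [mul_comm]
  rw [this]
  exact Ord_mL _

/-- order-`r` operators are controlled by products of at most `r` generators -/
lemma Ord.mem {r : ℕ} {D : Module.End ℂ (AA m)} (h : Ord r D) (L : Ideal (AA m))
    (hD : ∀ l : List (Gn m), l.length ≤ r → D (l.map X).prod ∈ L) (f : AA m) : D f ∈ L := by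
  induction r generalizing D f with
  | zero =>
    have h1 := LinearMap.congr_fun (h f) 1
    have h2 := hD [] (by simp)
    simp at h1 h2
    rw [sub_eq_zero.1 h1]
    exact L.mul_mem_left _ h2
  | succ r ih =>
    have key : ∀ (g : Gn m) (p : AA m), D (X g * p) - X g * D p ∈ L := by
      intro g p
      have := ih (h (X g)) (fun l hl => by
        have h1 := hD (g :: l) (by simpa using hl)
        have h2 := hD l (by omega)
        simp at h1 ⊢
        exact L.sub_mem h1 (L.mul_mem_left _ h2)) p
      simpa using this
    induction f using MvPolynomial.induction_on with
    | C c =>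
      have : (C c : AA m) = c • (1 : AA m) := by simp [MvPolynomial.smul_eq_C_mul]
      rw [this, map_smul, Algebra.smul_def]
      have h2 := hD [] (by simp)
      exact L.mul_mem_left _ (by simpa using h2)
    | add p q hp hq => rw [map_add]; exact L.add_mem hp hq
    | mul_X p g hp =>
      have h1 := L.add_mem (key g p) (L.mul_mem_left (X g) hp)
      rw [sub_add_cancel, mul_comm] at h1
      exact h1

/-- bihomogeneous differential operators -/
structure Op (r : ℕ) (p q : ℤ) (D : Module.End ℂ (AA m)) : Prop where
  ord : Ord r D
  sy : ∀ f, EY (D f) = D (EY f) + (p : ℂ) • D f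
  sx : ∀ f, EX (D f) = D (EX f) + (q : ℂ) • D f

lemma Op.add {r p q} {D D' : Module.End ℂ (AA m)} (h : Op r p q D) (h' : Op r p q D') :
    Op r p q (D + D') := by
  refine ⟨h.ord.add h'.ord, fun f => ?_, fun f => ?_⟩
  · simp only [LinearMap.add_apply, map_add, h.sy, h'.sy, smul_add]; abel
  · simp only [LinearMap.add_apply, map_add, h.sx, h'.sx, smul_add]; abel

lemma Op.smul {r p q} {D : Module.End ℂ (AA m)} (c : ℂ) (h : Op r p q D) :
    Op r p q (c • D) := by
  refine ⟨h.ord.smul c, fun f => ?_, fun f => ?_⟩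
  · rw [LinearMap.smul_apply, LinearMap.smul_apply, Derivation.map_smul, h.sy, smul_add, smul_comm c (p : ℂ)]
  · rw [LinearMap.smul_apply, LinearMap.smul_apply, Derivation.map_smul, h.sx, smul_add, smul_comm c (q : ℂ)]

lemma Op.sub {r p q} {D D' : Module.End ℂ (AA m)} (h : Op r p q D) (h' : Op r p q D') :
    Op r p q (D - D') := by
  rw [show D - D' = D + (-1 : ℂ) • D' by module]
  exact h.add (h'.smul _)

lemma Op.zero' (r p q) : Op r p q (0 : Module.End ℂ (AA m)) :=
  ⟨Ord.zero' r, by simp, by simp⟩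

lemma Op.sum {r p q} {ι : Type*} (s : Finset ι) {D : ι → Module.End ℂ (AA m)}
    (h : ∀ i, Op r p q (D i)) : Op r p q (∑ i ∈ s, D i) := by
  classical
  induction s using Finset.induction_on with
  | empty => simpa using Op.zero' r p q
  | insert a s ha ih => rw [Finset.sum_insert ha]; exact (h a).add ih

lemma Op.mul {r p q r' p' q'} {D D' : Module.End ℂ (AA m)} (h : Op r p q D)
    (h' : Op r' p' q' D') : Op (r + r') (p + p') (q + q') (D * D') := by
  refine ⟨h.ord.mul h'.ord, fun f => ?_, fun f => ?_⟩
  · simp only [Module.End.mul_apply, h.sy, h'.sy, map_add, map_smul]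
    push_cast; module
  · simp only [Module.End.mul_apply, h.sx, h'.sx, map_add, map_smul]
    push_cast; module

lemma Op.mono {r p q r'} {D : Module.End ℂ (AA m)} (h : Op r p q D) (hr : r ≤ r') :
    Op r' p q D := ⟨h.ord.mono hr, h.sy, h.sx⟩

lemma Op_mL {p q : ℤ} {a : AA m} (hy : EY a = (p : ℂ) • a) (hx : EX a = (q : ℂ) • a) :
    Op 0 p q (mL a) := by
  refine ⟨Ord_mL a, fun f => ?_, fun f => ?_⟩
  · simp [hy, Algebra.smul_def]; ring
  · simp [hx, Algebra.smul_def]; ring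

lemma Op_op {p q : ℤ} {P : Derivation ℂ (AA m) (AA m)}
    (h1 : ∀ i a, EY (P (xx i a)) = (p : ℂ) • P (xx i a))
    (h2 : ∀ i j a, EY (P (yy i j a)) = ((p : ℂ) + 1) • P (yy i j a))
    (h3 : ∀ i a, EX (P (xx i a)) = ((q : ℂ) + 1) • P (xx i a))
    (h4 : ∀ i j a, EX (P (yy i j a)) = (q : ℂ) • P (yy i j a)) :
    Op 1 p q (op P) := by
  refine ⟨Ord_op P, fun f => ?_, fun f => ?_⟩
  · have : ⁅(EY : Derivation ℂ (AA m) (AA m)), P⁆ = (p : ℂ) • P := by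
      apply der_ext
      · intro i a; simp [Derivation.commutator_apply, h1]
      · intro i j a; simp [Derivation.commutator_apply, h2, add_smul]
    have h := congrArg (fun Q : Derivation ℂ (AA m) (AA m) => Q f) this
    simp only [Derivation.commutator_apply, Derivation.smul_apply] at h
    simp only [op_apply]
    rw [← h]; abel
  · have : ⁅(EX : Derivation ℂ (AA m) (AA m)), P⁆ = (q : ℂ) • P := by
      apply der_ext
      · intro i a; simp [Derivation.commutator_apply, h3, add_smul]
      · intro i j a; simp [Derivation.commutator_apply, h4]
    have h := congrArg (fun Q : Derivation ℂ (AA m) (AA m) => Q f) this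
    simp only [Derivation.commutator_apply, Derivation.smul_apply] at h
    simp only [op_apply]
    rw [← h]; abel

/-! ### bidegrees of the basic derivations -/

lemma C2 : (C (2 : ℂ) : AA m) = 2 := map_ofNat C 2

lemma Op_NN : Op 1 0 0 (op (NN : Derivation ℂ (AA m) (AA m))) := by
  apply Op_op <;> intros <;> simp

lemma Op_EE (a b : Fin 3) : Op 1 0 0 (op (EE a b : Derivation ℂ (AA m) (AA m))) := by
  apply Op_op <;> intros <;> simp

lemma Op_dX (i : Fin m) (u) : Op 1 0 (-1) (op (dX i u)) := by
  apply Op_op <;> intros <;> simp [-map_mul]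

lemma Op_dY (i b : Fin m) (u) : Op 1 (-1) 0 (op (dY i b u)) := by
  apply Op_op <;> intros <;> simp only [dY_xx, dY_yy, map_zero, smul_zero, Derivation.map_algebraMap] <;> simp

lemma Op_DD (i : Fin m) (u) : Op 1 (-1) 1 (op (DD i u)) := by
  apply Op_op <;> intros <;> simp [em]

lemma Op_UU : Op 1 (-1) 2 (op (UU : Derivation ℂ (AA m) (AA m))) := by
  apply Op_op <;> intros <;> simp [Del, cr, Algebra.smul_def, C2] <;> ring

lemma EY_ZZ (a b d c : Fin m) (s) : EY (ZZ a b d c s) = (2 : ℂ) • ZZ a b d c s := by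
  simp [ZZ, cr, smul_sub, smul_smul, Algebra.smul_def, C2]; ring

lemma EX_ZZ (a b d c : Fin m) (s) : EX (ZZ a b d c s) = 0 := by
  simp [ZZ, cr]

lemma Op_VV (al) (b d : Fin m) (s) : Op 1 1 0 (op (VV al b d s)) := by
  apply Op_op
  · intro i a; simp [Finset.sum_mul, Finset.mul_sum, mul_comm]
  · intro i j a; simp only [VV_yy, map_neg, Derivation.map_smul, EY_ZZ]; push_cast; module
  · intro i a; simp
  · intro i j a; simp [EX_ZZ]

lemma Op_mLy (i j : Fin m) (a) : Op 0 1 0 (FT.mL (yy i j a)) := by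
  apply Op_mL <;> simp
lemma Op_mLDel (i j : Fin m) (a) : Op 0 0 2 (FT.mL (Del i j a)) := by
  apply Op_mL <;> simp [Del, cr, Algebra.smul_def, C2] <;> ring

lemma Op_one : Op 0 0 0 (1 : Module.End ℂ (AA m)) := by
  have := Op_mL (m := m) (p := 0) (q := 0) (a := 1) (by simp) (by simp)
  have h : FT.mL (1 : AA m) = 1 := by apply LinearMap.ext; intro f; simp
  rwa [h] at this

/-! ### the composite operators -/

def hh (al g de : Fin 3) (b d : Fin m) : Module.End ℂ (AA m) :=
  op (EE al g) * mL (yy b d de) - dl al g • (op NN * mL (yy b d de))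
    - (3 * dl al g) • mL (yy b d de)
    - ∑ s, ep de g s • (op (VV al b d s) - ∑ k, ep al s k • mL (yy b d k))

def HH (al : Fin 3) (i j : Fin m) : Module.End ℂ (AA m) :=
  ∑ b, ∑ d, ∑ g, ∑ de, hh al g de b d * (op (dY i b g) * op (dY j d de))

def PX (i j : Fin m) (be : Fin 3) : Module.End ℂ (AA m) :=
  cr (fun u => op (dX i u)) (fun u => op (dX j u)) be
def KK (i j : Fin m) (be : Fin 3) : Module.End ℂ (AA m) :=
  cr (fun u => op (DD i u)) (fun u => op (dX j u)) be
    + cr (fun u => op (dX i u)) (fun u => op (DD j u)) be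
def NN2 : Module.End ℂ (AA m) := op NN + (2 : ℂ) • 1
def F0 (al : Fin 3) (i j : Fin m) : Module.End ℂ (AA m) :=
  HH al i j + (∑ be, op (EE al be) * KK i j be - KK i j al * NN2)
def F1 (al : Fin 3) (i j : Fin m) : Module.End ℂ (AA m) :=
  ∑ be, op (EE al be) * PX i j be - PX i j al * NN2
def MM (a b : Fin 3) : Module.End ℂ (AA m) :=
  op (EE (a + 1) (b + 1)) * op (EE (a + 2) (b + 2)) - dl (b + 1) (a + 2) • op (EE (a + 1) (b + 2))
  - (op (EE (a + 1) (b + 2)) * op (EE (a + 2) (b + 1))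
    - dl (b + 2) (a + 2) • op (EE (a + 1) (b + 1)))
def CC : Module.End ℂ (AA m) :=
  ∑ a, ∑ b, op (EE a b) * MM a b - ∑ a, MM a a * op NN
def Dop : Module.End ℂ (AA m) :=
  (1 / 2 : ℂ) • (∑ i, ∑ j, ∑ al, (mL (yy i j al) * F0 al i j + mL (Del i j al) * F1 al i j)) - CC

lemma Op_hh (al g de) (b d : Fin m) : Op 1 1 0 (hh al g de b d) := by
  refine Op.sub (Op.sub (Op.sub ?_ ?_) ?_) ?_
  · exact (Op_EE al g).mul (Op_mLy b d de)
  · exact (Op_NN.mul (Op_mLy b d de)).smul _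
  · exact ((Op_mLy b d de).smul _).mono (by norm_num)
  · refine Op.sum _ fun s => ((Op_VV al b d s).sub ?_).smul _
    exact Op.sum _ fun k => ((Op_mLy b d k).smul _).mono (by norm_num)

lemma Op_HH (al) (i j : Fin m) : Op 3 (-1) 0 (HH al i j) := by
  refine Op.sum _ fun b => Op.sum _ fun d => Op.sum _ fun g => Op.sum _ fun de => ?_
  exact (Op_hh al g de b d).mul ((Op_dY i b g).mul (Op_dY j d de))

lemma Op_cr {r p q r' p' q'} {u v : Fin 3 → Module.End ℂ (AA m)}
    (hu : ∀ a, Op r p q (u a)) (hv : ∀ a, Op r' p' q' (v a)) (a : Fin 3) :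
    Op (r + r') (p + p') (q + q') (cr u v a) :=
  ((hu _).mul (hv _)).sub ((hu _).mul (hv _))

lemma Op_PX (i j : Fin m) (be) : Op 2 0 (-2) (PX i j be) :=
  Op_cr (fun u => Op_dX i u) (fun u => Op_dX j u) be
lemma Op_KK (i j : Fin m) (be) : Op 2 (-1) 0 (KK i j be) :=
  (Op_cr (fun u => Op_DD i u) (fun u => Op_dX j u) be).add
    (Op_cr (fun u => Op_dX i u) (fun u => Op_DD j u) be)
lemma Op_NN2 : Op 1 0 0 (NN2 : Module.End ℂ (AA m)) :=
  Op_NN.add ((Op_one.smul _).mono (by norm_num))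
lemma Op_F0 (al) (i j : Fin m) : Op 3 (-1) 0 (F0 al i j) :=
  (Op_HH al i j).add ((Op.sum _ fun be => (Op_EE al be).mul (Op_KK i j be)).sub
    ((Op_KK i j al).mul Op_NN2))
lemma Op_F1 (al) (i j : Fin m) : Op 3 0 (-2) (F1 al i j) :=
  ((Op.sum _ fun be => (Op_EE al be).mul (Op_PX i j be)).sub
    ((Op_PX i j al).mul Op_NN2))
lemma Op_MM (a b) : Op 2 0 0 (MM a b : Module.End ℂ (AA m)) :=
  (((Op_EE _ _).mul (Op_EE _ _)).sub (((Op_EE _ _).smul _).mono (by norm_num))).sub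
  (((Op_EE _ _).mul (Op_EE _ _)).sub (((Op_EE _ _).smul _).mono (by norm_num)))
lemma Op_CC : Op 3 0 0 (CC : Module.End ℂ (AA m)) :=
  (Op.sum _ fun a => Op.sum _ fun b => (Op_EE a b).mul (Op_MM a b)).sub
    (Op.sum _ fun a => (Op_MM a a).mul Op_NN)
lemma Op_Dop : Op 3 0 0 (Dop : Module.End ℂ (AA m)) := by
  refine Op.sub (Op.smul _ ?_) Op_CC
  refine Op.sum _ fun i => Op.sum _ fun j => Op.sum _ fun al => ?_
  exact ((Op_mLy i j al).mul (Op_F0 al i j)).add ((Op_mLDel i j al).mul (Op_F1 al i j))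

end
end FT


namespace FT
noncomputable section
variable {m : ℕ}

lemma der_sum_apply {ι : Type*} (s : Finset ι) (P : ι → Derivation ℂ (AA m) (AA m)) (f : AA m) :
    (∑ i ∈ s, P i) f = ∑ i ∈ s, P i f := by
  rw [← Derivation.coeFnAddMonoidHom_apply, map_sum, Finset.sum_apply]
  rfl
lemma Sder_sum_apply {ι : Type*} (s : Finset ι) (P : ι → Derivation ℂ (SS m) (SS m)) (f : SS m) :
    (∑ i ∈ s, P i) f = ∑ i ∈ s, P i f := by
  rw [← Derivation.coeFnAddMonoidHom_apply, map_sum, Finset.sum_apply]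
  rfl

lemma sum_dl {ι R : Type*} [Fintype ι] [DecidableEq ι] [AddCommMonoid R] [Module ℂ R]
    (a : ι) (F : ι → R) : ∑ b, dl b a • F b = F a := by
  simp [dl, ite_smul]
lemma sum_dl' {ι R : Type*} [Fintype ι] [DecidableEq ι] [AddCommMonoid R] [Module ℂ R]
    (a : ι) (F : ι → R) : ∑ b, dl a b • F b = F a := by
  simp [dl, ite_smul]

lemma DD_expand (i : Fin m) (u) (f : AA m) :
    DD i u f = ∑ b, ∑ g, em u (xx b) g * dY i b g f := by
  have : DD i u = ∑ b, ∑ g, em u (xx b) g • dY i b g := by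
    apply der_ext
    · intro j c; simp [der_sum_apply]
    · intro e f c
      simp only [der_sum_apply, Derivation.smul_apply, dY_yy, DD_yy, smul_eq_mul]
      have h1 : ∀ b g, em u (xx b) g *
          algebraMap ℂ (AA m) (dl g c * (dl i e * dl b f - dl i f * dl b e)) =
          dl b f • (dl g c • (dl i e • em u (xx b) g)) - dl b e • (dl g c • (dl i f • em u (xx b) g)) := by
        intro b g
        simp only [Algebra.smul_def, map_mul, map_sub]; ring
      simp only [h1, Finset.sum_sub_distrib, ← Finset.smul_sum, sum_dl]
  rw [this]
  simp [der_sum_apply]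

lemma dY_em (i b c : Fin m) (g v h : Fin 3) : dY i b g (em v (xx c) h) = 0 := by
  simp [em]

def CD (i j : Fin m) (be : Fin 3) : Module.End ℂ (AA m) :=
  cr (fun u => op (DD i u)) (fun u => op (DD j u)) be

lemma Op_CD (i j : Fin m) (be) : Op 2 (-2) 2 (CD i j be) :=
  Op_cr (fun u => Op_DD i u) (fun u => Op_DD j u) be

def WW (be g de : Fin 3) (b d : Fin m) : AA m :=
  dl be g • Del b d de - xx b be * ∑ s, ep de g s • xx d s

lemma DDDD (i j : Fin m) (u v) (f : AA m) : DD i u (DD j v f) =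
    ∑ b, ∑ d, ∑ g, ∑ de, em u (xx b) g * em v (xx d) de * dY i b g (dY j d de f) := by
  rw [DD_expand i u, DD_expand j v]
  simp only [map_sum, Derivation.leibniz, dY_em, smul_zero, add_zero, smul_eq_mul, Finset.mul_sum]
  apply Finset.sum_congr rfl; intro b _
  rw [Finset.sum_comm]
  refine Finset.sum_congr rfl fun d _ => Finset.sum_congr rfl fun g _ =>
    Finset.sum_congr rfl fun de _ => ?_
  ring

lemma em_em (b d : Fin m) (be g de : Fin 3) :
    em (be + 1) (xx b) g * em (be + 2) (xx d) de - em (be + 2) (xx b) g * em (be + 1) (xx d) de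
     = WW be g de b d := by
  simp only [em, WW, Del, cr, Fin.sum_univ_three]
  fin_cases be <;> fin_cases g <;> fin_cases de <;> simp [dl, ep] <;> ring

lemma CD_apply (i j : Fin m) (be) (f : AA m) : CD i j be f =
    ∑ b, ∑ d, ∑ g, ∑ de, WW be g de b d * dY i b g (dY j d de f) := by
  simp only [CD, cr, LinearMap.sub_apply, Module.End.mul_apply, op_apply, DDDD,
    ← Finset.sum_sub_distrib, ← sub_mul, em_em]

lemma sum3 (F : Fin 3 → SS m) : ∑ a, F a = F 0 + F 1 + F 2 := Fin.sum_univ_three F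

lemma phi_hhB (al s : Fin 3) (b d : Fin m) (q : AA m) :
    (∑ be, phi (EE al be (xx b be * xx d s * q))) - phi (NN (xx b al * xx d s * q))
      - 2 * phi (xx b al * xx d s * q) =
    phi (VV al b d s q) - ∑ k, ep al s k • phi (yy b d k * q) := by
  simp only [map_sub, map_smul, map_sum, phi_VV, 
    Derivation.leibniz, EE_xx, NN_xx, smul_eq_mul, map_mul,
    map_add, phi_xx, phi_yy, Fin.sum_univ_three, Algebra.smul_def, AlgHom.commutes, cr]
  generalize phi (EE al 0 q) = e0
  generalize phi (EE al 1 q) = e1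
  generalize phi (EE al 2 q) = e2
  generalize phi (NN q) = n
  generalize phi q = q'
  fin_cases al <;> fin_cases s <;> simp [dl, ep] <;> ring

lemma WW_mul (be g de : Fin 3) (b d : Fin m) (q : AA m) : WW be g de b d * q =
    dl be g • (Del b d de * q) - ∑ s, ep de g s • (xx b be * xx d s * q) := by
  rw [WW, sub_mul, smul_mul_assoc, Finset.mul_sum, Finset.sum_mul]
  congr 1
  refine Finset.sum_congr rfl fun s _ => ?_
  rw [mul_smul_comm, smul_mul_assoc]

lemma phi_hhA (al g de : Fin 3) (b d : Fin m) (q : AA m) :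
    phi (EE al g (Del b d de * q)) = phi (EE al g (yy b d de * q)) := by
  rw [phi_EE, phi_EE, map_mul phi, map_mul phi, phi_yy, phi_Del]

lemma phi_hhA2 (de : Fin 3) (b d : Fin m) (q : AA m) :
    phi (NN (Del b d de * q)) = phi (NN (yy b d de * q)) + phi (yy b d de * q) := by
  simp only [Del, cr, Derivation.leibniz, map_sub, map_add, map_mul, smul_eq_mul, NN_xx, NN_yy,
    phi_xx, phi_yy]
  ring

lemma phi_hh (al g de : Fin 3) (b d : Fin m) (q : AA m) :
    phi (hh al g de b d q) = (∑ be, phi (EE al be (WW be g de b d * q)))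
      - phi (NN (WW al g de b d * q)) - 2 * phi (WW al g de b d * q) := by
  have hD : phi (Del b d de * q) = phi (yy b d de * q) := by
    rw [map_mul, map_mul, phi_yy, phi_Del]
  have h1 : (∑ be, phi (EE al be (WW be g de b d * q))) = phi (EE al g (yy b d de * q)) -
      ∑ s, ep de g s • ∑ be, phi (EE al be (xx b be * xx d s * q)) := by
    simp only [WW_mul, map_sub, Derivation.map_smul, map_smul, map_sum, Finset.sum_sub_distrib,
      phi_hhA]
    rw [sum_dl, Finset.sum_comm]
    simp only [Finset.smul_sum]
  have h2 : phi (NN (WW al g de b d * q)) = dl al g • (phi (NN (yy b d de * q))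
      + phi (yy b d de * q)) - ∑ s, ep de g s • phi (NN (xx b al * xx d s * q)) := by
    simp only [WW_mul, map_sub, Derivation.map_smul, map_smul, map_sum, phi_hhA2]
  have h3 : 2 * phi (WW al g de b d * q) = (2 * dl al g) • phi (yy b d de * q)
      - ∑ s, ep de g s • (2 * phi (xx b al * xx d s * q)) := by
    rw [WW_mul, map_sub, map_smul, hD, map_sum, mul_sub, Finset.mul_sum]
    simp only [map_smul, mul_smul_comm, mul_smul, two_smul, two_mul]
    module
  have h4 := fun s => phi_hhB al s b d q
  have h5 : phi (hh al g de b d q) = phi (EE al g (yy b d de * q))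
      - dl al g • phi (NN (yy b d de * q)) - (3 * dl al g) • phi (yy b d de * q)
      - ∑ s, ep de g s • ((∑ be, phi (EE al be (xx b be * xx d s * q)))
        - phi (NN (xx b al * xx d s * q)) - 2 * phi (xx b al * xx d s * q)) := by
    simp only [h4, hh, LinearMap.sub_apply, LinearMap.smul_apply, LinearMap.sum_apply,
      Module.End.mul_apply, op_apply, mL_apply, map_sub, map_smul, map_sum]
  rw [h5, h1, h2, h3]
  simp only [smul_sub, Finset.sum_sub_distrib]
  module

lemma NN_eq (f : AA m) : NN f = EY f + EX f := rfl

lemma phi_HH (al : Fin 3) (i j : Fin m) (f : AA m) :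
    phi (HH al i j f) = (∑ be, phi (EE al be (CD i j be f))) - phi (CD i j al (NN2 f)) := by
  have hN : CD i j al (NN2 f) = NN (CD i j al f) + (2 : ℂ) • CD i j al f := by
    have e1 := (Op_CD i j al).sy f
    have e2 := (Op_CD i j al).sx f
    simp only [NN2, LinearMap.add_apply, LinearMap.smul_apply, op_apply, Module.End.one_apply,
      map_add, map_smul, NN_eq, e1, e2]
    push_cast
    module
  rw [hN]
  simp only [CD_apply, map_sum, map_add, map_smul, HH, LinearMap.sum_apply, Module.End.mul_apply,
    op_apply, phi_hh, Finset.sum_sub_distrib]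
  have : ∀ z : SS m, (2 : ℂ) • z = 2 * z := fun z => by rw [two_smul, two_mul]
  simp only [this, Finset.mul_sum]
  rw [sub_sub]
  congr 1
  conv_rhs => rw [Finset.sum_comm]
  refine Finset.sum_congr rfl fun b _ => ?_
  conv_rhs => rw [Finset.sum_comm]
  refine Finset.sum_congr rfl fun d _ => ?_
  conv_rhs => rw [Finset.sum_comm]
  refine Finset.sum_congr rfl fun g _ => ?_
  conv_rhs => rw [Finset.sum_comm]

/-- second-order operator on `S` -/
def cdS (i j : Fin m) (be : Fin 3) (g : SS m) : SS m :=
  dS i (be + 1) (dS j (be + 2) g) - dS i (be + 2) (dS j (be + 1) g)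

lemma phi_cdS (i j : Fin m) (be) (f : AA m) :
    phi (CD i j be f) + phi (KK i j be f) + phi (PX i j be f) = cdS i j be (phi f) := by
  simp only [cdS, ← phi_DX, CD, KK, PX, cr, LinearMap.sub_apply, LinearMap.add_apply,
    Module.End.mul_apply, op_apply, map_add, map_sub]
  ring

lemma phi_F (al : Fin 3) (i j : Fin m) (f : AA m) :
    phi (F0 al i j f) + phi (F1 al i j f) =
      ∑ be, ES al be (cdS i j be (phi f)) - cdS i j al (phi (NN2 f)) := by
  simp only [← phi_cdS, F0, F1, LinearMap.add_apply, LinearMap.sub_apply, LinearMap.sum_apply,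
    Module.End.mul_apply, op_apply, map_add, map_sub, map_sum, phi_HH, phi_EE,
    Finset.sum_add_distrib]
  ring

lemma ES_expand (a b : Fin 3) (g : SS m) : ES a b g = ∑ i, sx i a * dS i b g := by
  have : (ES a b : Derivation ℂ (SS m) (SS m)) = ∑ i, (sx i a) • dS i b := by
    apply Sder_ext
    intro j c
    simp only [Sder_sum_apply, Derivation.smul_apply, dS_sx, ES_sx, smul_eq_mul]
    have h1 : ∀ i, sx i a * algebraMap ℂ (SS m) (dl i j * dl b c) =
        dl i j • (dl b c • sx i a) := by
      intro i; simp only [Algebra.smul_def, map_mul]; ring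
    simp only [h1, sum_dl]
  rw [this, Sder_sum_apply]
  rfl

lemma ES_ES (a b c d : Fin 3) (g : SS m) : ES a b (ES c d g) - dl b c • ES a d g =
    ∑ i, ∑ j, sx i a * sx j c * dS i b (dS j d g) := by
  rw [ES_expand a b, ES_expand c d, ES_expand a d]
  simp only [map_sum, Derivation.leibniz, dS_sx, smul_eq_mul, Finset.mul_sum, Finset.smul_sum]
  rw [← Finset.sum_sub_distrib]
  refine Finset.sum_congr rfl fun i _ => ?_
  have h1 : ∀ j, sx i a * (sx j c * dS i b (dS j d g) + dS j d g * algebraMap ℂ (SS m) (dl i j * dl b c))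
     = sx i a * sx j c * dS i b (dS j d g) + dl i j • (dl b c • (sx i a * dS j d g)) := by
    intro j; simp only [Algebra.smul_def, map_mul]; ring
  simp only [h1, Finset.sum_add_distrib, sum_dl']
  ring

lemma dS_comm (i j : Fin m) (u v : Fin 3) (g : SS m) : dS i u (dS j v g) = dS j v (dS i u g) := by
  have : ⁅(dS i u : Derivation ℂ (SS m) (SS m)), dS j v⁆ = 0 := by
    apply Sder_ext
    intro k c
    rw [Derivation.commutator_apply, dS_sx, dS_sx, Derivation.map_algebraMap,
      Derivation.map_algebraMap]
    simp
  have h := congrArg (fun Q : Derivation ℂ (SS m) (SS m) => Q g) this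
  simp only [Derivation.commutator_apply] at h
  exact sub_eq_zero.1 h

lemma phi_MM (a b : Fin 3) (f : AA m) : phi (MM a b f) =
    (1 / 2 : ℂ) • ∑ i, ∑ j, cr (sx i) (sx j) a * cdS i j b (phi f) := by
  have h1 : phi (MM a b f) = ∑ i, ∑ j, sx i (a + 1) * sx j (a + 2) * cdS i j b (phi f) := by
    simp only [MM, LinearMap.sub_apply, LinearMap.smul_apply, Module.End.mul_apply, op_apply,
      map_sub, map_smul, phi_EE, ES_ES, cdS, mul_sub, Finset.sum_sub_distrib]
  have h2 : ∑ i, ∑ j, sx i (a + 2) * sx j (a + 1) * cdS i j b (phi f) = - phi (MM a b f) := by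
    rw [h1, Finset.sum_comm, ← Finset.sum_neg_distrib]
    refine Finset.sum_congr rfl fun i _ => ?_
    rw [← Finset.sum_neg_distrib]
    refine Finset.sum_congr rfl fun j _ => ?_
    have : cdS j i b (phi f) = - cdS i j b (phi f) := by
      rw [cdS, cdS, dS_comm j i, dS_comm j i]; ring
    rw [this]; ring
  simp only [cr, sub_mul, Finset.sum_sub_distrib]
  rw [h2, ← h1]
  module

lemma sum_ES_cr (i j : Fin m) (b : Fin 3) (h : SS m) : ∑ a, ES a b (cr (sx i) (sx j) a * h) =
    ∑ a, cr (sx i) (sx j) a * ES a b h - 2 * (cr (sx i) (sx j) b * h) := by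
  simp only [cr, Derivation.leibniz, map_sub, ES_sx, smul_eq_mul, Fin.sum_univ_three,
    Algebra.smul_def]
  fin_cases b <;> simp [dl] <;> ring

lemma phi_Dop (f : AA m) : phi (Dop f) = 0 := by
  have hN : ∀ i j a, cdS i j a (phi (NN2 f)) = cdS i j a (phi (NN f)) + 2 * cdS i j a (phi f) := by
    intro i j a
    have : NN2 f = NN f + (f + f) := by simp [NN2, two_smul]
    simp only [this, cdS, map_add]
    ring
  have h1 : phi (CC f) = (1 / 2 : ℂ) • ∑ i, ∑ j, ((∑ b, ∑ a, ES a b (cr (sx i) (sx j) a *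
      cdS i j b (phi f))) - ∑ a, cr (sx i) (sx j) a * cdS i j a (phi (NN f))) := by
    simp only [CC, LinearMap.sub_apply, LinearMap.sum_apply, Module.End.mul_apply, op_apply,
      map_sub, map_sum, phi_EE, phi_MM, Derivation.map_smul, ← Finset.smul_sum,
      Finset.sum_sub_distrib, smul_sub]
    congr 2
    · rw [Finset.sum_comm]
      have : ∀ F : Fin 3 → Fin 3 → Fin m → Fin m → SS m, ∑ b, ∑ a, ∑ i, ∑ j, F a b i j =
          ∑ i, ∑ j, ∑ b, ∑ a, F a b i j := by
        intro F
        simp only [Fin.sum_univ_three, Finset.sum_add_distrib]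
      exact this _
    · simp only [Fin.sum_univ_three, Finset.sum_add_distrib]
  rw [Dop, LinearMap.sub_apply, map_sub, h1]
  simp only [LinearMap.smul_apply, LinearMap.sum_apply, LinearMap.add_apply, Module.End.mul_apply,
    mL_apply, map_smul, map_sum, map_add, map_mul, phi_yy, phi_Del, ← mul_add, phi_F]
  rw [← smul_sub, ← Finset.sum_sub_distrib]
  convert smul_zero (1 / 2 : ℂ)
  refine Finset.sum_eq_zero fun i _ => ?_
  rw [← Finset.sum_sub_distrib]
  refine Finset.sum_eq_zero fun j _ => ?_
  simp only [sum_ES_cr, hN]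
  simp only [Fin.sum_univ_three]
  ring

end
end FT


namespace FT
noncomputable section
variable {m : ℕ}

/-- third cumulant of an operator -/
def tri (a b c : AA m) : Module.End ℂ (AA m) →ₗ[ℂ] AA m where
  toFun D := D (a * b * c) - a * D (b * c) - b * D (a * c) - c * D (a * b)
    + a * b * D c + a * c * D b + b * c * D a - a * b * c * D 1
  map_add' D D' := by simp only [LinearMap.add_apply]; ring
  map_smul' r D := by
    simp only [LinearMap.smul_apply, RingHom.id_apply, mul_smul_comm, smul_sub, smul_add]

lemma tri_apply (a b c : AA m) (D : Module.End ℂ (AA m)) : tri a b c D =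
    D (a * b * c) - a * D (b * c) - b * D (a * c) - c * D (a * b)
    + a * b * D c + a * c * D b + b * c * D a - a * b * c * D 1 := rfl

lemma tri_mL (a b c u : AA m) (D : Module.End ℂ (AA m)) : tri a b c (mL u * D) = u * tri a b c D := by
  simp only [tri_apply, Module.End.mul_apply, mL_apply]; ring

lemma tri_op2 (a b c : AA m) (P Q : Derivation ℂ (AA m) (AA m)) : tri a b c (op P * op Q) = 0 := by
  simp only [tri_apply, Module.End.mul_apply, op_apply, Derivation.leibniz, map_add, smul_eq_mul,
    Derivation.map_one_eq_zero, map_zero]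
  ring

lemma tri_op1 (a b c : AA m) (P : Derivation ℂ (AA m) (AA m)) : tri a b c (op P) = 0 := by
  simp only [tri_apply, Module.End.mul_apply, op_apply, Derivation.leibniz, map_add, smul_eq_mul,
    Derivation.map_one_eq_zero, map_zero]
  ring

/-- permanent-like symmetrization -/
def six (P Q R : AA m → AA m) (a b c : AA m) : AA m :=
  P a * (Q b * R c + Q c * R b) + P b * (Q a * R c + Q c * R a) + P c * (Q a * R b + Q b * R a)

lemma tri_op3 (a b c : AA m) (P Q R : Derivation ℂ (AA m) (AA m)) :
    tri a b c (op P * (op Q * op R)) = six P Q R a b c := by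
  simp only [tri_apply, Module.End.mul_apply, op_apply, Derivation.leibniz, map_add, smul_eq_mul,
    Derivation.map_one_eq_zero, map_zero, six]
  ring

lemma tri_op3u (a b c u : AA m) (P Q R : Derivation ℂ (AA m) (AA m)) :
    tri a b c (op P * (mL u * (op Q * op R))) = u * six P Q R a b c := by
  simp only [tri_apply, Module.End.mul_apply, op_apply, mL_apply, Derivation.leibniz, map_add,
    smul_eq_mul, Derivation.map_one_eq_zero, map_zero, six, mul_zero]
  ring

section cert
variable {R : Type*} [CommRing R] [Algebra ℂ R]
variable (x : Fin m → Fin 3 → R) (y : Fin m → Fin m → Fin 3 → R)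

def hx (e : Fin m) (et al g de : Fin 3) (b d : Fin m) : R :=
  y b d de * (dl g et • x e al - dl al g • x e et)
    - ∑ s, ep de g s • ((∑ k, ep et al k • y b e k) * x d s)

def TI (a b c d e : Fin m) (ga de et al : Fin 3) : R :=
  (y a c al * hx x y e et al ga de b d - y b c al * hx x y e et al ga de a d
    - y a d al * hx x y e et al ga de b c + y b d al * hx x y e et al ga de a c)
  + (y c a al * hx x y e et al de ga d b - y c b al * hx x y e et al de ga d a
    - y d a al * hx x y e et al de ga c b + y d b al * hx x y e et al de ga c a)

def ww (b : Fin m) (ga et be : Fin 3) : R :=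
  (∑ r, ep ga (be + 1) r • x b r) * algebraMap ℂ R (dl (be + 2) et)
    - (∑ r, ep ga (be + 2) r • x b r) * algebraMap ℂ R (dl (be + 1) et)

def TII (a b c d e : Fin m) (ga de et al be : Fin 3) : R :=
  -(dl al de • (y c d be * ((y a e al - y e a al) * ww x b ga et be
      - (y b e al - y e b al) * ww x a ga et be)))

def Ey (a b : Fin 3) (i j : Fin m) (c : Fin 3) : R := dl a b • y i j c - dl a c • y i j b
def Ex (a b : Fin 3) (i : Fin m) (c : Fin 3) : R := dl b c • x i a

def pm (P Q R' : Fin 3 → R) : R :=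
  P 0 * (Q 1 * R' 2 + Q 2 * R' 1) + P 1 * (Q 0 * R' 2 + Q 2 * R' 0) + P 2 * (Q 0 * R' 1 + Q 1 * R' 0)

/-- values of `E_{αβ}` on the three generators -/
def E3 (a b c d e : Fin m) (ga de et : Fin 3) (u v : Fin 3) : Fin 3 → R :=
  ![Ey y u v a b ga, Ey y u v c d de, Ex x u v e et]
def N3 (a b c d e : Fin m) (ga de et : Fin 3) : Fin 3 → R :=
  ![y a b ga, y c d de, x e et]

def TIII (a b c d e : Fin m) (ga de et : Fin 3) : R :=
  ∑ u, ∑ v, pm (fun k => E3 x y a b c d e ga de et u v k - dl u v • N3 x y a b c d e ga de et k)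
      (E3 x y a b c d e ga de et (u + 1) (v + 1)) (E3 x y a b c d e ga de et (u + 2) (v + 2))
    - ∑ u, ∑ v, pm (fun k => E3 x y a b c d e ga de et u v k - dl u v • N3 x y a b c d e ga de et k)
      (E3 x y a b c d e ga de et (u + 1) (v + 2)) (E3 x y a b c d e ga de et (u + 2) (v + 1))

def TT (a b c d e : Fin m) (ga de et : Fin 3) : R :=
  (1 / 2 : ℂ) • (∑ al, (TI x y a b c d e ga de et al +
    ∑ be, (TII x y a b c d e ga de et al be + TII x y c d a b e de ga et al be)))
  - TIII x y a b c d e ga de et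

end cert

section
variable (a b c d e : Fin m) (ga de et : Fin 3)

lemma tri_CC : tri (yy a b ga) (yy c d de) (xx e et) CC = TIII xx yy a b c d e ga de et := by
  have h1 : ∀ u v u' v' u2 v2, tri (yy a b ga) (yy c d de) (xx e et)
      (op (EE u v) * (op (EE u' v') * op (EE u2 v2))) = pm (E3 xx yy a b c d e ga de et u v)
      (E3 xx yy a b c d e ga de et u' v') (E3 xx yy a b c d e ga de et u2 v2) := by
    intro u v u' v' u2 v2
    rw [tri_op3]
    simp [six, pm, E3, Ey, Ex]
  have h2 : ∀ u' v' u2 v2, tri (yy a b ga) (yy c d de) (xx e et)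
      (op (EE u' v') * (op (EE u2 v2) * op NN)) = pm (N3 xx yy a b c d e ga de et)
      (E3 xx yy a b c d e ga de et u' v') (E3 xx yy a b c d e ga de et u2 v2) := by
    intro u' v' u2 v2
    rw [tri_op3]
    simp [six, pm, E3, N3, Ey, Ex, Algebra.smul_def]
    ring
  simp only [CC, MM, map_sub, map_sum, mul_sub, sub_mul, mul_smul_comm, smul_mul_assoc, mul_assoc,
    map_smul, h1, h2, tri_op2, smul_zero, sub_zero, TIII]
  have h3 : ∀ (P N Q R' : Fin 3 → AA m) (z : ℂ), pm (fun k => P k - z • N k) Q R' =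
      pm P Q R' - z • pm N Q R' := by
    intro P N Q R' z
    simp only [pm, Algebra.smul_def]; ring
  simp only [h3, Finset.sum_sub_distrib, sum_dl']
  ring

lemma tri_hh (al g de' : Fin 3) (b' d' i j : Fin m) :
    tri (yy a b ga) (yy c d de) (xx e et) (hh al g de' b' d' * (op (dY i b' g) * op (dY j d' de')))
    = hx xx yy e et al g de' b' d' * (dY i b' g (yy a b ga) * dY j d' de' (yy c d de)
      + dY i b' g (yy c d de) * dY j d' de' (yy a b ga)) := by
  have six0 : ∀ P : Derivation ℂ (AA m) (AA m), six P (dY i b' g) (dY j d' de') (yy a b ga) (yy c d de) (xx e et)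
     = P (xx e et) * (dY i b' g (yy a b ga) * dY j d' de' (yy c d de)
      + dY i b' g (yy c d de) * dY j d' de' (yy a b ga)) := by
    intro P
    simp only [six, dY_xx]; ring
  simp only [hh, sub_mul, Finset.sum_mul, smul_mul_assoc, mul_assoc, map_sub, map_sum, map_smul,
    tri_op3u, tri_op3, tri_mL, tri_op2, mul_zero, smul_zero, Finset.sum_const_zero, sub_zero, six0,
    EE_xx, NN_xx, VV_xx, hx]
  generalize (dY i b' g (yy a b ga) * dY j d' de' (yy c d de)
      + dY i b' g (yy c d de) * dY j d' de' (yy a b ga)) = Q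
  simp only [Algebra.smul_def, Finset.sum_mul, Finset.mul_sum]
  ring_nf

lemma collapse (F : Fin m → Fin m → Fin 3 → AA m) :
    ∑ i, ∑ b', ∑ g, F i b' g * dY i b' g (yy a b ga) = F a b ga - F b a ga := by
  have h1 : ∀ i b' g, F i b' g * dY i b' g (yy a b ga) =
      dl i a • (dl b' b • (dl g ga • F i b' g)) - dl i b • (dl b' a • (dl g ga • F i b' g)) := by
    intro i b' g
    simp only [dY_yy, Algebra.smul_def, map_mul, map_sub]; ring
  simp only [h1, Finset.sum_sub_distrib, ← Finset.smul_sum, sum_dl]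

end
end
end FT


namespace FT
noncomputable section
variable {m : ℕ}
section
variable (a b c d e : Fin m) (ga de et : Fin 3)

lemma collapse2 (F : Fin m → Fin m → Fin m → Fin m → Fin 3 → Fin 3 → AA m) :
    ∑ i, ∑ j, ∑ b', ∑ d', ∑ g, ∑ de', F i j b' d' g de' *
      (dY i b' g (yy a b ga) * dY j d' de' (yy c d de)) =
    F a c b d ga de - F b c a d ga de - F a d b c ga de + F b d a c ga de := by
  have h1 : ∀ i j b' d' g de', F i j b' d' g de' *
      (dY i b' g (yy a b ga) * dY j d' de' (yy c d de)) =
      dl i a • (dl j c • (dl b' b • (dl d' d • (dl g ga • (dl de' de • F i j b' d' g de')))))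
      - dl i b • (dl j c • (dl b' a • (dl d' d • (dl g ga • (dl de' de • F i j b' d' g de')))))
      - dl i a • (dl j d • (dl b' b • (dl d' c • (dl g ga • (dl de' de • F i j b' d' g de')))))
      + dl i b • (dl j d • (dl b' a • (dl d' c • (dl g ga • (dl de' de • F i j b' d' g de'))))) := by
    intro i j b' d' g de'
    simp only [dY_yy, Algebra.smul_def, map_mul, map_sub]; ring
  simp only [h1, Finset.sum_sub_distrib, Finset.sum_add_distrib, ← Finset.smul_sum, sum_dl]

lemma tri_H (al : Fin 3) : ∑ i, ∑ j, yy i j al * tri (yy a b ga) (yy c d de) (xx e et) (HH al i j)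
    = TI xx yy a b c d e ga de et al := by
  have e1 := collapse2 a b c d ga de (fun i j b' d' g de' => yy i j al * hx xx yy e et al g de' b' d')
  have e2 := collapse2 c d a b de ga (fun i j b' d' g de' => yy i j al * hx xx yy e et al g de' b' d')
  simp only [mul_assoc] at e1 e2
  simp only [HH, map_sum, tri_hh, Finset.mul_sum, mul_add, Finset.sum_add_distrib, e1, e2]
  simp only [TI]; ring

/-- the value of `KK` on a pair `(y, x)` -/
def kv (i j : Fin m) (be : Fin 3) : AA m :=
  DD i (be + 1) (yy a b ga) * dX j (be + 2) (xx e et)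
  - DD i (be + 2) (yy a b ga) * dX j (be + 1) (xx e et)
  + (dX i (be + 1) (xx e et) * DD j (be + 2) (yy a b ga)
  - dX i (be + 2) (xx e et) * DD j (be + 1) (yy a b ga))

lemma tri_EK (i j : Fin m) (al be : Fin 3) :
    tri (yy a b ga) (yy c d de) (xx e et) (op (EE al be) * KK i j be - dl al be • (KK i j be * NN2))
    = -(dl al de • (yy c d be * kv a b e ga et i j be))
      -(dl al ga • (yy a b be * kv c d e de et i j be)) := by
  have e1 : ∀ P Q : Derivation ℂ (AA m) (AA m),
     tri (yy a b ga) (yy c d de) (xx e et) (op P * op Q * NN2) =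
     tri (yy a b ga) (yy c d de) (xx e et) (op P * (op Q * op NN)) := by
    intro P Q
    rw [NN2, mul_add, map_add, mul_smul_comm, map_smul, mul_one, tri_op2, smul_zero, add_zero, mul_assoc]
  simp only [KK, cr, mul_add, mul_sub, add_mul, sub_mul, map_add, map_sub, map_smul, e1, tri_op3]
  simp only [six, kv, DD_xx, dX_yy, EE_yy, NN_yy, Algebra.smul_def]
  ring

lemma kv_sum (al be : Fin 3) : ∑ i, ∑ j, yy i j al * kv a b e ga et i j be =
    (yy a e al - yy e a al) * ww xx b ga et be - (yy b e al - yy e b al) * ww xx a ga et be := by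
  have h1 : ∀ i j, yy i j al * kv a b e ga et i j be =
     dl j e • (dl i a • (yy i j al * ww xx b ga et be)) - dl j e • (dl i b • (yy i j al * ww xx a ga et be))
     - (dl j a • (dl i e • (yy i j al * ww xx b ga et be)) - dl j b • (dl i e • (yy i j al * ww xx a ga et be))) := by
    intro i j
    simp only [kv, ww, DD_yy, dX_xx, em, Algebra.smul_def, map_mul]; ring
  simp only [h1]
  rw [Finset.sum_comm]
  simp only [Finset.sum_sub_distrib, ← Finset.smul_sum, sum_dl]
  ring

lemma tri_K (al : Fin 3) : ∑ i, ∑ j, yy i j al * tri (yy a b ga) (yy c d de) (xx e et)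
      (∑ be, op (EE al be) * KK i j be - KK i j al * NN2) =
    ∑ be, (TII xx yy a b c d e ga de et al be + TII xx yy c d a b e de ga et al be) := by
  have h : ∀ i j : Fin m, (∑ be, op (EE al be) * KK i j be - KK i j al * NN2) =
     ∑ be, (op (EE al be) * KK i j be - dl al be • (KK i j be * NN2)) := by
    intro i j
    rw [Finset.sum_sub_distrib]
    congr 1
    rw [sum_dl']
  simp only [h, map_sum, tri_EK, Finset.mul_sum]
  have h2 : ∀ be, ∑ i, ∑ j, yy i j al * (-(dl al de • (yy c d be * kv a b e ga et i j be))
      -(dl al ga • (yy a b be * kv c d e de et i j be))) =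
      -(dl al de • (yy c d be * ∑ i, ∑ j, yy i j al * kv a b e ga et i j be))
      -(dl al ga • (yy a b be * ∑ i, ∑ j, yy i j al * kv c d e de et i j be)) := by
    intro be
    simp only [Finset.mul_sum, Finset.smul_sum, ← Finset.sum_neg_distrib, ← Finset.sum_sub_distrib]
    refine Finset.sum_congr rfl fun i _ => Finset.sum_congr rfl fun j _ => ?_
    simp only [Algebra.smul_def]; ring
  have h3 : ∀ F : Fin m → Fin m → Fin 3 → AA m, ∑ i, ∑ j, ∑ be, F i j be = ∑ be, ∑ i, ∑ j, F i j be := by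
    intro F
    simp only [Finset.sum_comm (t := (Finset.univ : Finset (Fin 3)))]
  rw [h3]
  refine Finset.sum_congr rfl fun be _ => ?_
  rw [h2, kv_sum, kv_sum]
  simp only [TII]; ring

lemma tri_F1 (i j : Fin m) (al : Fin 3) :
    tri (yy a b ga) (yy c d de) (xx e et) (F1 al i j) = 0 := by
  have e1 : ∀ P Q : Derivation ℂ (AA m) (AA m),
     tri (yy a b ga) (yy c d de) (xx e et) (op P * op Q * NN2) =
     tri (yy a b ga) (yy c d de) (xx e et) (op P * (op Q * op NN)) := by
    intro P Q
    rw [NN2, mul_add, map_add, mul_smul_comm, map_smul, mul_one, tri_op2, smul_zero, add_zero, mul_assoc]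
  simp only [F1, PX, cr, mul_sub, sub_mul, map_sub, map_sum, e1, tri_op3]
  simp [six]

lemma tri_Dop : tri (yy a b ga) (yy c d de) (xx e et) Dop = TT xx yy a b c d e ga de et := by
  have h3 : ∀ F : Fin m → Fin m → Fin 3 → AA m, ∑ i, ∑ j, ∑ be, F i j be = ∑ be, ∑ i, ∑ j, F i j be := by
    intro F
    simp only [Finset.sum_comm (t := (Finset.univ : Finset (Fin 3)))]
  have h4 : tri (yy a b ga) (yy c d de) (xx e et)
      (∑ i, ∑ j, ∑ al, (mL (yy i j al) * F0 al i j + mL (Del i j al) * F1 al i j)) =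
      ∑ al, (TI xx yy a b c d e ga de et al +
    ∑ be, (TII xx yy a b c d e ga de et al be + TII xx yy c d a b e de ga et al be)) := by
    have h5 : ∀ i j : Fin m, ∀ al, tri (yy a b ga) (yy c d de) (xx e et)
        (mL (yy i j al) * F0 al i j + mL (Del i j al) * F1 al i j) =
        yy i j al * tri (yy a b ga) (yy c d de) (xx e et) (HH al i j) +
        yy i j al * tri (yy a b ga) (yy c d de) (xx e et)
          (∑ be, op (EE al be) * KK i j be - KK i j al * NN2) := by
      intro i j al
      rw [map_add, tri_mL, tri_mL, tri_F1, mul_zero, add_zero, F0, map_add, mul_add]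
    simp_rw [map_sum, h5]
    rw [h3]
    refine Finset.sum_congr rfl fun al _ => ?_
    rw [← tri_H, ← tri_K]
    simp only [Finset.sum_add_distrib]
  rw [Dop, map_sub, map_smul, h4, tri_CC, TT]
end
end
end FT


namespace FT
noncomputable section
variable {m : ℕ}

section cert
variable {R : Type*} [CommRing R] [Algebra ℂ R]

lemma dl_self {ι : Type*} [DecidableEq ι] (a : ι) : dl a a = 1 := by simp [dl]
lemma dl_ne {ι : Type*} [DecidableEq ι] {a b : ι} (h : a ≠ b) : dl a b = 0 := by simp [dl, h]
lemma dl01 (n : Fin 3) : dl n (n + 1) = 0 := dl_ne (by revert n; decide)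
lemma dl10 (n : Fin 3) : dl (n + 1) n = 0 := dl_ne (by revert n; decide)
lemma dl02 (n : Fin 3) : dl n (n + 2) = 0 := dl_ne (by revert n; decide)
lemma dl20 (n : Fin 3) : dl (n + 2) n = 0 := dl_ne (by revert n; decide)
lemma dl12 (n : Fin 3) : dl (n + 1) (n + 2) = 0 := dl_ne (by revert n; decide)
lemma dl21 (n : Fin 3) : dl (n + 2) (n + 1) = 0 := dl_ne (by revert n; decide)
lemma n11 (n : Fin 3) : n + 1 + 1 = n + 2 := by revert n; decide
lemma n12 (n : Fin 3) : n + 1 + 2 = n := by revert n; decide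
lemma n21 (n : Fin 3) : n + 2 + 1 = n := by revert n; decide
lemma n22 (n : Fin 3) : n + 2 + 2 = n + 1 := by revert n; decide
lemma ep_aa (a c : Fin 3) : ep a a c = 0 := by fin_cases a <;> simp [ep]
lemma ep_bb (a c : Fin 3) : ep a c c = 0 := by fin_cases a <;> fin_cases c <;> simp [ep]
lemma ep_ab (a c : Fin 3) : ep a c a = 0 := by fin_cases a <;> fin_cases c <;> simp [ep]
lemma ep012 (n : Fin 3) : ep n (n + 1) (n + 2) = 1 := by fin_cases n <;> simp [ep]
lemma ep120 (n : Fin 3) : ep (n + 1) (n + 2) n = 1 := by fin_cases n <;> simp [ep]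
lemma ep201 (n : Fin 3) : ep (n + 2) n (n + 1) = 1 := by fin_cases n <;> simp [ep]
lemma ep021 (n : Fin 3) : ep n (n + 2) (n + 1) = -1 := by fin_cases n <;> simp [ep]
lemma ep102 (n : Fin 3) : ep (n + 1) n (n + 2) = -1 := by fin_cases n <;> simp [ep]
lemma ep210 (n : Fin 3) : ep (n + 2) (n + 1) n = -1 := by fin_cases n <;> simp [ep]
lemma sumn3 {M : Type*} [AddCommMonoid M] (n : Fin 3) (F : Fin 3 → M) :
    ∑ a, F a = F n + F (n + 1) + F (n + 2) := by
  rw [Fin.sum_univ_three]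
  fin_cases n
  · rfl
  · change _ = F 1 + F 2 + F 0; abel
  · change _ = F 2 + F 0 + F 1; abel

/-- the relations used for the certificates -/
structure Rel (x : Fin m → Fin 3 → R) (y : Fin m → Fin m → Fin 3 → R) : Prop where
  anti : ∀ a b g, y b a g = -y a b g
  L0 : ∀ a b c α β, α ≠ β → x a α * y b c β - x b α * y a c β + x c α * y a b β = 0
  L1 : ∀ a b c α, x a α * y b c α - x b α * y a c α + x c α * y a b α = ∑ r, x a r * y b c r
  S : ∀ a b c, ∑ r, x a r * y b c r = ∑ r, x b r * y c a r
  P : ∀ a b c d g h, (y a b g * y c d h - y a c g * y b d h + y a d g * y b c h)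
    + (y a b h * y c d g - y a c h * y b d g + y a d h * y b c g) = 0

lemma half_cancel {A B : R} (h : 2 * A - 4 * B = 0) : (1 / 2 : ℂ) • A - B = 0 := by
  have h2 : algebraMap ℂ R (1 / 2) * 2 = 1 := by
    rw [show (2 : R) = algebraMap ℂ R 2 from (map_ofNat _ 2).symm, ← map_mul]; norm_num
  rw [Algebra.smul_def]
  set t := algebraMap ℂ R (1 / 2)
  linear_combination t * t * h - (t * A - B - 2 * t * B) * h2

set_option maxHeartbeats 1000000 in
lemma cert00 {x : Fin m → Fin 3 → R} {y : Fin m → Fin m → Fin 3 → R} (H : Rel x y)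
    (a b c d e : Fin m) (n : Fin 3) : TT x y a b c d e n n n = 0 := by
  have n01 : n ≠ n + 1 := by revert n; decide
  have n02 : n ≠ n + 2 := by revert n; decide
  have n12' : n + 1 ≠ n + 2 := by revert n; decide
  have hL0 := H.L0
  have hP := H.P
  apply half_cancel
  simp only [TI, TII, TIII, hx, ww, Ey, Ex, pm, E3, N3, sumn3 n, n11, n12, n21, n22, dl_self, dl01, dl10,
    dl02, dl20, dl12, dl21, ep_aa, ep_bb, ep_ab, ep012, ep120, ep201, ep021, ep102, ep210, zero_smul,
    one_smul, neg_smul, map_zero, map_one, mul_zero, zero_mul, mul_one, add_zero, zero_add, sub_zero,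
    zero_sub, sub_self, neg_zero, Matrix.cons_val_zero, Matrix.cons_val_one, Matrix.cons_val]
  simp only [H.anti a b, H.anti a c, H.anti a d, H.anti a e, H.anti b c, H.anti b d, H.anti b e,
    H.anti c d, H.anti c e, H.anti d e]
  linear_combination (-4) * y c d (n + 1) * hL0 a b e (n + 1) n n01.symm
    + (-4) * y c d (n + 2) * hL0 a b e (n + 2) n n02.symm
    + (-4) * y a b (n + 2) * hL0 c d e (n + 2) n n02.symm
    + (-4) * y a b (n + 1) * hL0 c d e (n + 1) n n01.symm
    + (-4) * x e (n + 1) * hP a b c d n (n + 1)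
    + (-4) * x e (n + 2) * hP a b c d n (n + 2)

set_option maxHeartbeats 1000000 in
lemma cert01 {x : Fin m → Fin 3 → R} {y : Fin m → Fin m → Fin 3 → R} (H : Rel x y)
    (a b c d e : Fin m) (n : Fin 3) : TT x y a b c d e n (n + 1) n = 0 := by
  have n01 : n ≠ n + 1 := by revert n; decide
  have n02 : n ≠ n + 2 := by revert n; decide
  have n12' : n + 1 ≠ n + 2 := by revert n; decide
  have hL1 := H.L1
  have hS := H.S
  have hL0 := H.L0
  have hP := H.P
  simp only [sumn3 n] at hL1 hS
  apply half_cancel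
  simp only [TI, TII, TIII, hx, ww, Ey, Ex, pm, E3, N3, sumn3 n, n11, n12, n21, n22, dl_self, dl01, dl10,
    dl02, dl20, dl12, dl21, ep_aa, ep_bb, ep_ab, ep012, ep120, ep201, ep021, ep102, ep210, zero_smul,
    one_smul, neg_smul, map_zero, map_one, mul_zero, zero_mul, mul_one, add_zero, zero_add, sub_zero,
    zero_sub, sub_self, neg_zero, Matrix.cons_val_zero, Matrix.cons_val_one, Matrix.cons_val]
  simp only [H.anti a b, H.anti a c, H.anti a d, H.anti a e, H.anti b c, H.anti b d, H.anti b e,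
    H.anti c d, H.anti c e, H.anti d e]
  linear_combination (2) * x a (n + 2) * hP b c d e (n + 1) (n + 2)
    + (2) * y b d (n + 2) * hL0 a c e (n + 2) (n + 1) n12'.symm
    + (-6) * y c d (n + 2) * hL0 a b e (n + 2) (n + 1) n12'.symm
    + (-2) * y c e (n + 1) * hL1 a b d (n + 2)
    + (2) * y b d (n + 1) * hL1 a c e (n + 2)
    + (4) * y c e (n + 2) * hL0 a b d (n + 2) (n + 1) n12'.symm
    + (-2) * x b (n + 2) * hP a c d e (n + 1) (n + 2)
    + (-4) * y c d (n + 1) * hL1 a b e (n + 1)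
    + (-4) * y a e (n + 2) * hL0 b c d (n + 2) (n + 1) n12'.symm
    + (2) * y c e n * hL0 a b d n (n + 1) n01
    + (-2) * y a d (n + 1) * hL1 b c e (n + 2)
    + (-4) * y a b (n + 1) * hL1 c d e (n + 1)
    + (2) * y c e (n + 1) * hL1 a b d (n + 1)
    + (-2) * y a d (n + 2) * hL0 b c e (n + 2) (n + 1) n12'.symm
    + (-6) * y c d (n + 1) * hL1 a b e (n + 2)
    + (6) * y a b (n + 1) * hS d e c
    + (-10) * y c d (n + 1) * hS b e a
    + (-10) * y c d (n + 1) * hS a b e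
    + (-4) * y d e (n + 2) * hL0 a b c (n + 2) (n + 1) n12'.symm
    + (2) * x d (n + 2) * hP a b c e (n + 1) (n + 2)
    + (2) * x e n * hP a b c d n (n + 1)
    + (-2) * x e (n + 1) * hP a b c d (n + 1) (n + 1)
    + (4) * y b e (n + 2) * hL0 a c d (n + 2) (n + 1) n12'.symm
    + (-6) * y a b (n + 1) * x d n * H.anti c e n
    + (-6) * y a b (n + 1) * x d (n + 1) * H.anti c e (n + 1)
    + (-6) * y a b (n + 1) * x d (n + 2) * H.anti c e (n + 2)
    + (10) * y c d (n + 1) * x b n * H.anti a e n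
    + (10) * y c d (n + 1) * x b (n + 1) * H.anti a e (n + 1)
    + (10) * y c d (n + 1) * x b (n + 2) * H.anti a e (n + 2)
    + (-10) * y c d (n + 1) * x b n * H.anti a e n
    + (-10) * y c d (n + 1) * x b (n + 1) * H.anti a e (n + 1)
    + (-10) * y c d (n + 1) * x b (n + 2) * H.anti a e (n + 2)

set_option maxHeartbeats 1000000 in
lemma cert02 {x : Fin m → Fin 3 → R} {y : Fin m → Fin m → Fin 3 → R} (H : Rel x y)
    (a b c d e : Fin m) (n : Fin 3) : TT x y a b c d e n (n + 2) n = 0 := by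
  have n01 : n ≠ n + 1 := by revert n; decide
  have n02 : n ≠ n + 2 := by revert n; decide
  have n12' : n + 1 ≠ n + 2 := by revert n; decide
  have hL1 := H.L1
  have hS := H.S
  have hL0 := H.L0
  have hP := H.P
  simp only [sumn3 n] at hL1 hS
  apply half_cancel
  simp only [TI, TII, TIII, hx, ww, Ey, Ex, pm, E3, N3, sumn3 n, n11, n12, n21, n22, dl_self, dl01, dl10,
    dl02, dl20, dl12, dl21, ep_aa, ep_bb, ep_ab, ep012, ep120, ep201, ep021, ep102, ep210, zero_smul,
    one_smul, neg_smul, map_zero, map_one, mul_zero, zero_mul, mul_one, add_zero, zero_add, sub_zero,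
    zero_sub, sub_self, neg_zero, Matrix.cons_val_zero, Matrix.cons_val_one, Matrix.cons_val]
  simp only [H.anti a b, H.anti a c, H.anti a d, H.anti a e, H.anti b c, H.anti b d, H.anti b e,
    H.anti c d, H.anti c e, H.anti d e]
  linear_combination (2) * y b d (n + 2) * hL1 a c e (n + 2)
    + (-2) * x b (n + 1) * hP a c d e (n + 1) (n + 2)
    + (-6) * y d e (n + 1) * hL0 a b c (n + 1) (n + 2) n12'
    + (-4) * y c d (n + 2) * hL1 a b e (n + 1)
    + (-2) * y d e (n + 2) * hL1 a b c (n + 2)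
    + (-2) * x a n * hP b c d e n (n + 2)
    + (-4) * y c d (n + 1) * hL0 a b e (n + 1) (n + 2) n12'
    + (-2) * y a e (n + 2) * hL1 b c d (n + 2)
    + (-4) * y a b (n + 2) * hL1 c d e (n + 2)
    + (2) * y a e (n + 2) * hL1 b c d (n + 1)
    + (-2) * y b e (n + 2) * hL1 a c d (n + 1)
    + (2) * y b e (n + 1) * hL0 a c d (n + 1) (n + 2) n12'
    + (-8) * y c d (n + 2) * hL1 a b e (n + 2)
    + (-2) * y a e (n + 1) * hL0 b c d (n + 1) (n + 2) n12'
    + (2) * y a b (n + 2) * hS c d e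
    + (4) * y c e (n + 1) * hL0 a b d (n + 1) (n + 2) n12'
    + (6) * y a b (n + 2) * hS d e c
    + (-10) * y c d (n + 2) * hS b e a
    + (-10) * y c d (n + 2) * hS a b e
    + (-1) * x b (n + 2) * hP a c d e (n + 2) (n + 2)
    + (2) * y c e (n + 2) * hL1 a b d (n + 2)
    + (-4) * y b c (n + 2) * hL1 a d e (n + 2)
    + (2) * x e n * hP a b c d n (n + 2)
    + (-2) * x e (n + 1) * hP a b c d (n + 1) (n + 2)
    + (-2) * y d e n * hL0 a b c n (n + 2) n02
    + (2) * y a c (n + 2) * hL1 b d e (n + 2)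
    + (-1) * x d (n + 2) * hP a b c e (n + 2) (n + 2)
    + (2) * y a b (n + 2) * x d n * H.anti c e n
    + (2) * y a b (n + 2) * x d (n + 1) * H.anti c e (n + 1)
    + (2) * y a b (n + 2) * x d (n + 2) * H.anti c e (n + 2)
    + (-6) * y a b (n + 2) * x d n * H.anti c e n
    + (-6) * y a b (n + 2) * x d (n + 1) * H.anti c e (n + 1)
    + (-6) * y a b (n + 2) * x d (n + 2) * H.anti c e (n + 2)
    + (10) * y c d (n + 2) * x b n * H.anti a e n
    + (10) * y c d (n + 2) * x b (n + 1) * H.anti a e (n + 1)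
    + (10) * y c d (n + 2) * x b (n + 2) * H.anti a e (n + 2)
    + (-10) * y c d (n + 2) * x b n * H.anti a e n
    + (-10) * y c d (n + 2) * x b (n + 1) * H.anti a e (n + 1)
    + (-10) * y c d (n + 2) * x b (n + 2) * H.anti a e (n + 2)

set_option maxHeartbeats 1000000 in
lemma cert10 {x : Fin m → Fin 3 → R} {y : Fin m → Fin m → Fin 3 → R} (H : Rel x y)
    (a b c d e : Fin m) (n : Fin 3) : TT x y a b c d e (n + 1) n n = 0 := by
  have n01 : n ≠ n + 1 := by revert n; decide
  have n02 : n ≠ n + 2 := by revert n; decide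
  have n12' : n + 1 ≠ n + 2 := by revert n; decide
  have hL1 := H.L1
  have hS := H.S
  have hL0 := H.L0
  have hP := H.P
  simp only [sumn3 n] at hL1 hS
  apply half_cancel
  simp only [TI, TII, TIII, hx, ww, Ey, Ex, pm, E3, N3, sumn3 n, n11, n12, n21, n22, dl_self, dl01, dl10,
    dl02, dl20, dl12, dl21, ep_aa, ep_bb, ep_ab, ep012, ep120, ep201, ep021, ep102, ep210, zero_smul,
    one_smul, neg_smul, map_zero, map_one, mul_zero, zero_mul, mul_one, add_zero, zero_add, sub_zero,
    zero_sub, sub_self, neg_zero, Matrix.cons_val_zero, Matrix.cons_val_one, Matrix.cons_val]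
  simp only [H.anti a b, H.anti a c, H.anti a d, H.anti a e, H.anti b c, H.anti b d, H.anti b e,
    H.anti c d, H.anti c e, H.anti d e]
  linear_combination (2) * y d e (n + 1) * hL1 a b c (n + 2)
    + (2) * x a n * hP b c d e n (n + 1)
    + (-2) * y c e (n + 1) * hL1 a b d (n + 2)
    + (2) * y b d (n + 1) * hL1 a c e (n + 2)
    + (-4) * x a (n + 2) * hP b c d e (n + 1) (n + 2)
    + (2) * y b c (n + 2) * hL0 a d e (n + 2) (n + 1) n12'.symm
    + (-2) * y b c (n + 1) * hL1 a d e (n + 2)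
    + (-2) * y b d (n + 2) * hL0 a c e (n + 2) (n + 1) n12'.symm
    + (4) * y c d (n + 2) * hL0 a b e (n + 2) (n + 1) n12'.symm
    + (2) * y c d (n + 1) * hS a b e
    + (4) * y a c (n + 1) * hL1 b d e (n + 2)
    + (-6) * y c e (n + 2) * hL0 a b d (n + 2) (n + 1) n12'.symm
    + (4) * x b (n + 2) * hP a c d e (n + 1) (n + 2)
    + (2) * x b (n + 1) * hP a c d e (n + 1) (n + 1)
    + (4) * y c e n * hL0 a b d n (n + 1) n01
    + (-4) * y a d (n + 1) * hL1 b c e (n + 2)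
    + (-8) * y a b (n + 1) * hL1 c d e (n + 1)
    + (2) * y b e (n + 1) * hL1 a c d (n + 2)
    + (-14) * y a b (n + 1) * hS c d e
    + (-6) * y a b (n + 2) * hL0 c d e (n + 2) (n + 1) n12'.symm
    + (-10) * y a b (n + 1) * hS d e c
    + (6) * y c d (n + 1) * hS b e a
    + (6) * y d e (n + 2) * hL0 a b c (n + 2) (n + 1) n12'.symm
    + (-10) * y a b (n + 1) * hL1 c d e (n + 2)
    + (-4) * y d e n * hL0 a b c n (n + 1) n01
    + (2) * x e n * hP a b c d n (n + 1)
    + (-2) * x e (n + 1) * hP a b c d (n + 1) (n + 1)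
    + (2) * y b e (n + 2) * hL0 a c d (n + 2) (n + 1) n12'.symm
    + (2) * y c d (n + 1) * x b n * H.anti a e n
    + (2) * y c d (n + 1) * x b (n + 1) * H.anti a e (n + 1)
    + (2) * y c d (n + 1) * x b (n + 2) * H.anti a e (n + 2)
    + (-14) * y a b (n + 1) * x d n * H.anti c e n
    + (-14) * y a b (n + 1) * x d (n + 1) * H.anti c e (n + 1)
    + (-14) * y a b (n + 1) * x d (n + 2) * H.anti c e (n + 2)
    + (10) * y a b (n + 1) * x d n * H.anti c e n
    + (10) * y a b (n + 1) * x d (n + 1) * H.anti c e (n + 1)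
    + (10) * y a b (n + 1) * x d (n + 2) * H.anti c e (n + 2)
    + (-6) * y c d (n + 1) * x b n * H.anti a e n
    + (-6) * y c d (n + 1) * x b (n + 1) * H.anti a e (n + 1)
    + (-6) * y c d (n + 1) * x b (n + 2) * H.anti a e (n + 2)

set_option maxHeartbeats 1000000 in
lemma cert11 {x : Fin m → Fin 3 → R} {y : Fin m → Fin m → Fin 3 → R} (H : Rel x y)
    (a b c d e : Fin m) (n : Fin 3) : TT x y a b c d e (n + 1) (n + 1) n = 0 := by
  have n01 : n ≠ n + 1 := by revert n; decide
  have n02 : n ≠ n + 2 := by revert n; decide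
  have n12' : n + 1 ≠ n + 2 := by revert n; decide
  have hL0 := H.L0
  have hP := H.P
  apply half_cancel
  simp only [TI, TII, TIII, hx, ww, Ey, Ex, pm, E3, N3, sumn3 n, n11, n12, n21, n22, dl_self, dl01, dl10,
    dl02, dl20, dl12, dl21, ep_aa, ep_bb, ep_ab, ep012, ep120, ep201, ep021, ep102, ep210, zero_smul,
    one_smul, neg_smul, map_zero, map_one, mul_zero, zero_mul, mul_one, add_zero, zero_add, sub_zero,
    zero_sub, sub_self, neg_zero, Matrix.cons_val_zero, Matrix.cons_val_one, Matrix.cons_val]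
  simp only [H.anti a b, H.anti a c, H.anti a d, H.anti a e, H.anti b c, H.anti b d, H.anti b e,
    H.anti c d, H.anti c e, H.anti d e]
  linear_combination (4) * y c d (n + 1) * hL0 a b e n (n + 1) n01
    + (4) * y a b (n + 1) * hL0 c d e n (n + 1) n01
    + (4) * x e n * hP a b c d (n + 1) (n + 1)

set_option maxHeartbeats 1000000 in
lemma cert12 {x : Fin m → Fin 3 → R} {y : Fin m → Fin m → Fin 3 → R} (H : Rel x y)
    (a b c d e : Fin m) (n : Fin 3) : TT x y a b c d e (n + 1) (n + 2) n = 0 := by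
  have n01 : n ≠ n + 1 := by revert n; decide
  have n02 : n ≠ n + 2 := by revert n; decide
  have n12' : n + 1 ≠ n + 2 := by revert n; decide
  have hL0 := H.L0
  have hP := H.P
  apply half_cancel
  simp only [TI, TII, TIII, hx, ww, Ey, Ex, pm, E3, N3, sumn3 n, n11, n12, n21, n22, dl_self, dl01, dl10,
    dl02, dl20, dl12, dl21, ep_aa, ep_bb, ep_ab, ep012, ep120, ep201, ep021, ep102, ep210, zero_smul,
    one_smul, neg_smul, map_zero, map_one, mul_zero, zero_mul, mul_one, add_zero, zero_add, sub_zero,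
    zero_sub, sub_self, neg_zero, Matrix.cons_val_zero, Matrix.cons_val_one, Matrix.cons_val]
  simp only [H.anti a b, H.anti a c, H.anti a d, H.anti a e, H.anti b c, H.anti b d, H.anti b e,
    H.anti c d, H.anti c e, H.anti d e]
  linear_combination (-2) * y d e (n + 2) * hL0 a b c n (n + 1) n01
    + (2) * y c e (n + 2) * hL0 a b d n (n + 1) n01
    + (-2) * y c e (n + 1) * hL0 a b d n (n + 2) n02
    + (2) * x c n * hP a b d e (n + 1) (n + 2)
    + (2) * y d e (n + 1) * hL0 a b c n (n + 2) n02
    + (4) * y c d (n + 1) * hL0 a b e n (n + 2) n02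
    + (4) * y c d (n + 2) * hL0 a b e n (n + 1) n01
    + (-4) * y b e (n + 1) * hL0 a c d n (n + 2) n02
    + (4) * y a e (n + 1) * hL0 b c d n (n + 2) n02
    + (-2) * x d n * hP a b c e (n + 1) (n + 2)
    + (4) * x e n * hP a b c d (n + 1) (n + 2)

set_option maxHeartbeats 1000000 in
lemma cert20 {x : Fin m → Fin 3 → R} {y : Fin m → Fin m → Fin 3 → R} (H : Rel x y)
    (a b c d e : Fin m) (n : Fin 3) : TT x y a b c d e (n + 2) n n = 0 := by
  have n01 : n ≠ n + 1 := by revert n; decide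
  have n02 : n ≠ n + 2 := by revert n; decide
  have n12' : n + 1 ≠ n + 2 := by revert n; decide
  have hL1 := H.L1
  have hS := H.S
  have hL0 := H.L0
  have hP := H.P
  simp only [sumn3 n] at hL1 hS
  apply half_cancel
  simp only [TI, TII, TIII, hx, ww, Ey, Ex, pm, E3, N3, sumn3 n, n11, n12, n21, n22, dl_self, dl01, dl10,
    dl02, dl20, dl12, dl21, ep_aa, ep_bb, ep_ab, ep012, ep120, ep201, ep021, ep102, ep210, zero_smul,
    one_smul, neg_smul, map_zero, map_one, mul_zero, zero_mul, mul_one, add_zero, zero_add, sub_zero,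
    zero_sub, sub_self, neg_zero, Matrix.cons_val_zero, Matrix.cons_val_one, Matrix.cons_val]
  simp only [H.anti a b, H.anti a c, H.anti a d, H.anti a e, H.anti b c, H.anti b d, H.anti b e,
    H.anti c d, H.anti c e, H.anti d e]
  linear_combination (2) * y d e (n + 2) * hL1 a b c (n + 2)
    + (2) * x a n * hP b c d e n (n + 2)
    + (-2) * y b d (n + 2) * hL1 a c e (n + 2)
    + (2) * x b (n + 1) * hP a c d e (n + 1) (n + 2)
    + (-2) * y d e (n + 1) * hL0 a b c (n + 1) (n + 2) n12'
    + (2) * y c d (n + 2) * hS a b e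
    + (-4) * y a b (n + 1) * hL0 c d e (n + 1) (n + 2) n12'
    + (-4) * y a b (n + 2) * hL1 c d e (n + 1)
    + (-12) * y a b (n + 2) * hL1 c d e (n + 2)
    + (-2) * y b e (n + 1) * hL0 a c d (n + 1) (n + 2) n12'
    + (2) * y a e (n + 2) * hL1 b c d (n + 2)
    + (2) * y a e (n + 1) * hL0 b c d (n + 1) (n + 2) n12'
    + (-2) * y a e (n + 2) * hL1 b c d (n + 1)
    + (2) * y b e (n + 2) * hL1 a c d (n + 1)
    + (-10) * y a b (n + 2) * hS c d e
    + (6) * y c d (n + 2) * hS b e a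
    + (-4) * y c e (n + 1) * hL0 a b d (n + 1) (n + 2) n12'
    + (-10) * y a b (n + 2) * hS d e c
    + (1) * x b (n + 2) * hP a c d e (n + 2) (n + 2)
    + (-2) * y c e (n + 2) * hL1 a b d (n + 2)
    + (-4) * y b c (n + 2) * hL1 a d e (n + 2)
    + (2) * x e n * hP a b c d n (n + 2)
    + (-2) * x e (n + 1) * hP a b c d (n + 1) (n + 2)
    + (-6) * y d e n * hL0 a b c n (n + 2) n02
    + (6) * y a c (n + 2) * hL1 b d e (n + 2)
    + (-3) * x d (n + 2) * hP a b c e (n + 2) (n + 2)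
    + (2) * y c d (n + 2) * x b n * H.anti a e n
    + (2) * y c d (n + 2) * x b (n + 1) * H.anti a e (n + 1)
    + (2) * y c d (n + 2) * x b (n + 2) * H.anti a e (n + 2)
    + (-10) * y a b (n + 2) * x d n * H.anti c e n
    + (-10) * y a b (n + 2) * x d (n + 1) * H.anti c e (n + 1)
    + (-10) * y a b (n + 2) * x d (n + 2) * H.anti c e (n + 2)
    + (-6) * y c d (n + 2) * x b n * H.anti a e n
    + (-6) * y c d (n + 2) * x b (n + 1) * H.anti a e (n + 1)
    + (-6) * y c d (n + 2) * x b (n + 2) * H.anti a e (n + 2)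
    + (10) * y a b (n + 2) * x d n * H.anti c e n
    + (10) * y a b (n + 2) * x d (n + 1) * H.anti c e (n + 1)
    + (10) * y a b (n + 2) * x d (n + 2) * H.anti c e (n + 2)

set_option maxHeartbeats 1000000 in
lemma cert21 {x : Fin m → Fin 3 → R} {y : Fin m → Fin m → Fin 3 → R} (H : Rel x y)
    (a b c d e : Fin m) (n : Fin 3) : TT x y a b c d e (n + 2) (n + 1) n = 0 := by
  have n01 : n ≠ n + 1 := by revert n; decide
  have n02 : n ≠ n + 2 := by revert n; decide
  have n12' : n + 1 ≠ n + 2 := by revert n; decide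
  have hL0 := H.L0
  have hP := H.P
  apply half_cancel
  simp only [TI, TII, TIII, hx, ww, Ey, Ex, pm, E3, N3, sumn3 n, n11, n12, n21, n22, dl_self, dl01, dl10,
    dl02, dl20, dl12, dl21, ep_aa, ep_bb, ep_ab, ep012, ep120, ep201, ep021, ep102, ep210, zero_smul,
    one_smul, neg_smul, map_zero, map_one, mul_zero, zero_mul, mul_one, add_zero, zero_add, sub_zero,
    zero_sub, sub_self, neg_zero, Matrix.cons_val_zero, Matrix.cons_val_one, Matrix.cons_val]
  simp only [H.anti a b, H.anti a c, H.anti a d, H.anti a e, H.anti b c, H.anti b d, H.anti b e,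
    H.anti c d, H.anti c e, H.anti d e]
  linear_combination (-2) * y d e (n + 1) * hL0 a b c n (n + 2) n02
    + (-2) * y c e (n + 2) * hL0 a b d n (n + 1) n01
    + (2) * y c e (n + 1) * hL0 a b d n (n + 2) n02
    + (4) * y b e (n + 1) * hL0 a c d n (n + 2) n02
    + (2) * y d e (n + 2) * hL0 a b c n (n + 1) n01
    + (-4) * y a e (n + 1) * hL0 b c d n (n + 2) n02
    + (-2) * x c n * hP a b d e (n + 1) (n + 2)
    + (4) * y a b (n + 1) * hL0 c d e n (n + 2) n02
    + (4) * y a b (n + 2) * hL0 c d e n (n + 1) n01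
    + (2) * x d n * hP a b c e (n + 1) (n + 2)
    + (4) * x e n * hP a b c d (n + 1) (n + 2)

set_option maxHeartbeats 1000000 in
lemma cert22 {x : Fin m → Fin 3 → R} {y : Fin m → Fin m → Fin 3 → R} (H : Rel x y)
    (a b c d e : Fin m) (n : Fin 3) : TT x y a b c d e (n + 2) (n + 2) n = 0 := by
  have n01 : n ≠ n + 1 := by revert n; decide
  have n02 : n ≠ n + 2 := by revert n; decide
  have n12' : n + 1 ≠ n + 2 := by revert n; decide
  have hL0 := H.L0
  have hP := H.P
  apply half_cancel
  simp only [TI, TII, TIII, hx, ww, Ey, Ex, pm, E3, N3, sumn3 n, n11, n12, n21, n22, dl_self, dl01, dl10,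
    dl02, dl20, dl12, dl21, ep_aa, ep_bb, ep_ab, ep012, ep120, ep201, ep021, ep102, ep210, zero_smul,
    one_smul, neg_smul, map_zero, map_one, mul_zero, zero_mul, mul_one, add_zero, zero_add, sub_zero,
    zero_sub, sub_self, neg_zero, Matrix.cons_val_zero, Matrix.cons_val_one, Matrix.cons_val]
  simp only [H.anti a b, H.anti a c, H.anti a d, H.anti a e, H.anti b c, H.anti b d, H.anti b e,
    H.anti c d, H.anti c e, H.anti d e]
  linear_combination (4) * y c d (n + 2) * hL0 a b e n (n + 2) n02
    + (4) * y a b (n + 2) * hL0 c d e n (n + 2) n02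
    + (4) * x e n * hP a b c d (n + 2) (n + 2)

lemma Fin3_cases (n g : Fin 3) : g = n ∨ g = n + 1 ∨ g = n + 2 := by
  revert n g; decide

lemma TT_zero {x : Fin m → Fin 3 → R} {y : Fin m → Fin m → Fin 3 → R} (H : Rel x y)
    (a b c d e : Fin m) (ga de n : Fin 3) : TT x y a b c d e ga de n = 0 := by
  rcases Fin3_cases n ga with h | h | h <;> rcases Fin3_cases n de with h' | h' | h' <;> rw [h, h']
  · exact cert00 H a b c d e n
  · exact cert01 H a b c d e n
  · exact cert02 H a b c d e n
  · exact cert10 H a b c d e n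
  · exact cert11 H a b c d e n
  · exact cert12 H a b c d e n
  · exact cert20 H a b c d e n
  · exact cert21 H a b c d e n
  · exact cert22 H a b c d e n
end cert
end
end FT


namespace FT
noncomputable section
variable {m : ℕ}

/-! ### Euler derivations -/

lemma euler {σ : Type*} (w : σ → ℕ) (P : Derivation ℂ (MvPolynomial σ ℂ) (MvPolynomial σ ℂ))
    (hP : ∀ g, P (X g) = (w g : ℂ) • X g) (s : σ →₀ ℕ) (f : MvPolynomial σ ℂ) :
    coeff s (P f) = ((Finsupp.weight w s : ℕ) : ℂ) * coeff s f := by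
  classical
  induction f using MvPolynomial.induction_on generalizing s with
  | C c =>
    have : P (C c) = 0 := P.map_algebraMap c
    rw [this, coeff_C]
    split_ifs with h
    · subst h; simp
    · simp
  | add p q hp hq => rw [map_add, coeff_add, hp, hq, coeff_add]; ring
  | mul_X p g hp =>
    rw [Derivation.leibniz, hP, smul_eq_mul, smul_eq_mul, mul_smul_comm, coeff_add, coeff_smul,
      mul_comm (X g), coeff_mul_X', coeff_mul_X']
    split_ifs with h
    · rw [hp]
      have hs : s = (s - Finsupp.single g 1) + Finsupp.single g 1 := by
        rw [tsub_add_cancel_of_le]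
        rw [Finsupp.single_le_iff]
        exact Nat.one_le_iff_ne_zero.2 (Finsupp.mem_support_iff.1 h)
      conv_rhs => rw [hs]
      rw [map_add, Finsupp.weight_single, add_tsub_cancel_right]
      simp; ring
    · simp

/-! ### the ideal -/

def LL (m : ℕ) : Ideal (AA m) :=
  Ideal.span ({f | EY f = f ∧ phi f = 0} ∪
    {f | EX f = 0 ∧ phi f = 0 ∧ ∃ k : ℕ, EY f = (k : ℂ) • f})

def wY : Gn m → ℕ := Sum.elim (fun _ => 0) (fun _ => 1)
def wX : Gn m → ℕ := Sum.elim (fun _ => 1) (fun _ => 0)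

lemma EY_X (g : Gn m) : EY (X g : AA m) = (wY g : ℂ) • X g := by
  rcases g with ⟨i, a⟩ | ⟨i, j, a⟩
  · have h := EY_xx i a
    simp only [xx] at h
    simp [wY, h]
  · have h := EY_yy i j a
    simp only [yy] at h
    simp [wY, h]
lemma EX_X (g : Gn m) : EX (X g : AA m) = (wX g : ℂ) • X g := by
  rcases g with ⟨i, a⟩ | ⟨i, j, a⟩
  · have h := EX_xx i a
    simp only [xx] at h
    simp [wX, h]
  · have h := EX_yy i j a
    simp only [yy] at h
    simp [wX, h]

lemma eq_zero_of_EY {f : AA m} (h : EY f = 0) (hf : phi f = 0) : f = 0 := by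
  have hv : ∀ g ∈ f.vars, wY g = 0 := by
    intro g hg
    obtain ⟨s, hs, hgs⟩ := (mem_vars g).1 hg
    have h1 := euler wY EY EY_X s f
    rw [h, coeff_zero] at h1
    have h2 : coeff s f ≠ 0 := mem_support_iff.1 hs
    have h3 : Finsupp.weight wY s = 0 := by
      have := (mul_eq_zero.1 h1.symm).resolve_right h2
      exact_mod_cast this
    have h4 := Finsupp.le_weight wY (s := g) 
    by_contra hne
    have := Finsupp.le_weight wY hne s
    rw [h3] at this
    exact (Finsupp.mem_support_iff.1 hgs) (by omega)
  have h5 : ((rename (Sum.inl : Fin m × Fin 3 → Gn m)).comp phi : AA m →ₐ[ℂ] AA m) f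
      = (AlgHom.id ℂ (AA m)) f := by
    apply MvPolynomial.hom_congr_vars (f₁ := (((rename (Sum.inl : Fin m × Fin 3 → Gn m)).comp phi : AA m →ₐ[ℂ] AA m) : AA m →+* AA m)) (f₂ := ((AlgHom.id ℂ (AA m) : AA m →ₐ[ℂ] AA m) : AA m →+* AA m)) 
    · ext c; simp
    · intro g hg _
      have := hv g hg
      rcases g with ⟨i, a⟩ | ⟨i, j, a⟩
      · have := phi_xx (m := m) i a
        simp only [xx] at this
        simp [this, sx]
      · simp [wY] at this
    · rfl
  simp [hf] at h5
  exact h5.symm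

lemma mem_LL {f : AA m} {k d : ℕ} (h0 : phi f = 0) (hy : EY f = (k : ℂ) • f)
    (hx : EX f = (d : ℂ) • f) (hkd : k ≤ 1 ∨ d = 0) : f ∈ LL m := by
  by_cases hd : d = 0
  · subst hd
    exact Ideal.subset_span (Or.inr ⟨by simpa using hx, h0, k, hy⟩)
  · have hk : k ≤ 1 := by omega
    interval_cases k
    · rw [eq_zero_of_EY (by simpa using hy) h0]; exact Ideal.zero_mem _
    · exact Ideal.subset_span (Or.inl ⟨by simpa using hy, h0⟩)

/-! ### the relations in the quotient -/

lemma mem11 {f : AA m} (h0 : phi f = 0) (hy : EY f = f) : f ∈ LL m := 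
  Ideal.subset_span (Or.inl ⟨hy, h0⟩)
lemma memY {f : AA m} (k : ℕ) (h0 : phi f = 0) (hy : EY f = (k : ℂ) • f) (hx : EX f = 0) : f ∈ LL m := 
  Ideal.subset_span (Or.inr ⟨hx, h0, k, hy⟩)

lemma Rel_quot : Rel (fun i a => Ideal.Quotient.mkₐ ℂ (LL m) (xx i a))
    (fun i j a => Ideal.Quotient.mkₐ ℂ (LL m) (yy i j a)) := by
  have hz : ∀ f : AA m, f ∈ LL m → Ideal.Quotient.mkₐ ℂ (LL m) f = 0 := by
    intro f hf
    exact Ideal.Quotient.eq_zero_iff_mem.2 hf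
  constructor
  · intro a b g
    rw [eq_neg_iff_add_eq_zero, ← map_add]
    apply hz
    apply mem11
    · simp only [map_add, phi_yy, cr]; ring
    · simp only [map_add, EY_yy]
  · intro a b c α β hab
    simp only [← map_mul, ← map_add, ← map_sub]
    apply hz
    apply mem11
    · simp only [map_add, map_sub, map_mul phi, phi_yy, phi_xx, cr]
      fin_cases α <;> fin_cases β <;> first | exact absurd rfl hab | (simp; ring)
    · simp
  · intro a b c α 
    rw [← sub_eq_zero]
    simp only [← map_mul, ← map_sum, ← map_add, ← map_sub]
    apply hz
    apply mem11
    · simp only [map_add, map_sub, map_sum, map_mul phi, phi_yy, phi_xx, cr, Fin.sum_univ_three]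
      fin_cases α <;> (simp; ring)
    · simp
  · intro a b c
    rw [← sub_eq_zero]
    simp only [← map_mul, ← map_sum, ← map_add, ← map_sub]
    apply hz
    apply mem11
    · simp only [map_add, map_sub, map_sum, map_mul phi, phi_yy, phi_xx, cr, Fin.sum_univ_three]
      simp; ring
    · simp
  · intro a b c d g h
    simp only [← map_mul, ← map_sum, ← map_add, ← map_sub]
    apply hz
    apply memY 2
    · simp only [map_add, map_sub, map_sum, map_mul phi, phi_yy, phi_xx, cr]
      fin_cases g <;> fin_cases h <;> (simp; ring)
    · simp [Algebra.smul_def, C2]; ring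
    · simp

lemma TT_map {R R' : Type*} [CommRing R] [Algebra ℂ R] [CommRing R'] [Algebra ℂ R'] (F : R →ₐ[ℂ] R')
    (x : Fin m → Fin 3 → R) (y : Fin m → Fin m → Fin 3 → R)
    (a b c d e : Fin m) (ga de et : Fin 3) :
    TT (fun i a => F (x i a)) (fun i j a => F (y i j a)) a b c d e ga de et =
      F (TT x y a b c d e ga de et) := by
  simp only [TT, TI, TII, TIII, hx, ww, Ey, Ex, pm, E3, N3, map_sub, map_add, map_neg, map_mul F, map_sum,
    map_smul F, Matrix.cons_val_zero, Matrix.cons_val_one, Matrix.cons_val, AlgHom.commutes]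

lemma TT_mem (a b c d e : Fin m) (ga de et : Fin 3) : TT xx yy a b c d e ga de et ∈ LL m := by
  have h := TT_zero Rel_quot a b c d e ga de et
  rw [TT_map] at h
  exact Ideal.Quotient.eq_zero_iff_mem.1 h

lemma Dop_bi {f : AA m} {k d : ℕ} (hy : EY f = (k : ℂ) • f) (hx : EX f = (d : ℂ) • f)
    (hkd : k ≤ 1 ∨ d = 0) : Dop f ∈ LL m := by
  refine mem_LL (k := k) (d := d) (phi_Dop f) ?_ ?_ hkd
  · rw [Op_Dop.sy, hy, map_smul]; simp
  · rw [Op_Dop.sx, hx, map_smul]; simp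

lemma Dop_yyx (a b c d e : Fin m) (ga de et : Fin 3) :
    Dop (yy a b ga * yy c d de * xx e et) ∈ LL m := by
  have h := TT_mem a b c d e ga de et
  rw [← tri_Dop, tri_apply] at h
  have h1 : Dop (yy c d de * xx e et) ∈ LL m := Dop_bi (k := 1) (d := 1) (by simp [mul_comm]) (by simp) (by simp)
  have h2 : Dop (yy a b ga * xx e et) ∈ LL m := Dop_bi (k := 1) (d := 1) (by simp [mul_comm]) (by simp) (by simp)
  have h3 : Dop (yy a b ga * yy c d de) ∈ LL m := Dop_bi (k := 2) (d := 0)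
    (by simp [Algebra.smul_def, C2]; ring) (by simp) (by simp)
  have h4 : Dop (xx e et : AA m) ∈ LL m := Dop_bi (k := 0) (d := 1) (by simp) (by simp) (by simp)
  have h5 : Dop (yy c d de : AA m) ∈ LL m := Dop_bi (k := 1) (d := 0) (by simp) (by simp) (by simp)
  have h6 : Dop (yy a b ga : AA m) ∈ LL m := Dop_bi (k := 1) (d := 0) (by simp) (by simp) (by simp)
  have h7 : Dop (1 : AA m) ∈ LL m := Dop_bi (k := 0) (d := 0) (by simp) (by simp) (by simp)
  have h8 := Ideal.add_mem _ (Ideal.sub_mem _ (Ideal.sub_mem _ (Ideal.sub_mem _ (Ideal.add_mem _ (Ideal.add_mem _ (Ideal.add_mem _ h (Ideal.mul_mem_left _ (yy a b ga) h1))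
    (Ideal.mul_mem_left _ (yy c d de) h2)) (Ideal.mul_mem_left _ (xx e et) h3))
    (Ideal.mul_mem_left _ (yy a b ga * yy c d de) h4)) (Ideal.mul_mem_left _ (yy a b ga * xx e et) h5))
    (Ideal.mul_mem_left _ (yy c d de * xx e et) h6)) (Ideal.mul_mem_left _ (yy a b ga * yy c d de * xx e et) h7)
  convert h8 using 1
  ring

lemma EY_prod (l : List (Gn m)) : EY ((l.map X).prod : AA m) = (((l.map wY).sum : ℕ) : ℂ) • (l.map X).prod := by
  induction l with
  | nil => simp
  | cons g l ih =>
    simp only [List.map_cons, List.prod_cons, List.sum_cons, Derivation.leibniz, ih, EY_X, smul_eq_mul]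
    push_cast
    simp only [Algebra.smul_def, map_add]; ring
lemma EX_prod (l : List (Gn m)) : EX ((l.map X).prod : AA m) = (((l.map wX).sum : ℕ) : ℂ) • (l.map X).prod := by
  induction l with
  | nil => simp
  | cons g l ih =>
    simp only [List.map_cons, List.prod_cons, List.sum_cons, Derivation.leibniz, ih, EX_X, smul_eq_mul]
    push_cast
    simp only [Algebra.smul_def, map_add]; ring
lemma wX_wY (g : Gn m) : wX g + wY g = 1 := by rcases g with g | g <;> rfl

lemma Dop_mem (f : AA m) : Dop f ∈ LL m := by
  refine Op_Dop.ord.mem (LL m) ?_ f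
  intro l hl
  by_cases hkd : (l.map wY).sum ≤ 1 ∨ (l.map wX).sum = 0
  · exact Dop_bi (EY_prod l) (EX_prod l) hkd
  · push Not at hkd
    match l, hl, hkd with
    | [], _, hkd => simp at hkd
    | [g], _, hkd =>
      have := wX_wY g
      simp at hkd; omega
    | [g, g'], _, hkd =>
      have := wX_wY g
      have := wX_wY g'
      simp at hkd; omega
    | [g1, g2, g3], _, hkd =>
      rcases g1 with ⟨i1, a1⟩ | ⟨i1, j1, a1⟩ <;> rcases g2 with ⟨i2, a2⟩ | ⟨i2, j2, a2⟩ <;>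
        rcases g3 with ⟨i3, a3⟩ | ⟨i3, j3, a3⟩ <;> simp [wX, wY] at hkd
      · have := Dop_yyx i2 j2 i3 j3 i1 a2 a3 a1
        simp only [List.map_cons, List.map_nil, List.prod_cons, List.prod_nil, mul_one]
        convert this using 2
        simp only [xx, yy]; ring
      · have := Dop_yyx i1 j1 i3 j3 i2 a1 a3 a2
        simp only [List.map_cons, List.map_nil, List.prod_cons, List.prod_nil, mul_one]
        convert this using 2
        simp only [xx, yy]; ring
      · have := Dop_yyx i1 j1 i2 j2 i3 a1 a2 a3
        simp only [List.map_cons, List.map_nil, List.prod_cons, List.prod_nil, mul_one]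
        convert this using 2
        simp only [xx, yy]; ring
    | g1 :: g2 :: g3 :: g4 :: l, hl, _ => simp at hl; omega
end
end FT


namespace FT
noncomputable section
variable {m : ℕ}

/-! ### The Casimir-type operator on highest weight vectors -/
section cas
variable {V : Type*} [AddCommGroup V] [Module ℂ V] (e : Fin 3 → Fin 3 → Module.End ℂ V)

def GG (w0 w1 w2 n : ℂ) : ℂ :=
  (n + 2) * ((w0 + 1) * w1 + (w0 + 1) * w2 + (w1 + 1) * w2) - 3 * (w0 + 2) * (w1 + 1) * w2

def mm (a b : Fin 3) (v : V) : V :=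
  e (a + 1) (b + 1) (e (a + 2) (b + 2) v) - dl (b + 1) (a + 2) • e (a + 1) (b + 2) v
  - (e (a + 1) (b + 2) (e (a + 2) (b + 1) v) - dl (b + 2) (a + 2) • e (a + 1) (b + 1) v)

set_option maxHeartbeats 1000000 in
lemma cas (hc : ∀ a b c d v, e a b (e c d v) = e c d (e a b v) + dl b c • e a d v - dl a d • e c b v)
    (v : V) (w0 w1 w2 n : ℂ) (h00 : e 0 0 v = w0 • v) (h11 : e 1 1 v = w1 • v) (h22 : e 2 2 v = w2 • v)
    (h01 : e 0 1 v = 0) (h02 : e 0 2 v = 0) (h12 : e 1 2 v = 0) :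
    ∑ a, ∑ b, e a b (mm e a b v) - n • ∑ a, mm e a a v = -(GG w0 w1 w2 n • v) := by
  have q : ∀ a b c d : Fin 3, ∀ v, e a b (e c d v) = e c d (e a b v) + (if b = c then (1:ℂ) else 0) • e a d v
    - (if a = d then (1:ℂ) else 0) • e c b v := hc
  have c1 := q 0 1 1 0 
  have c2 := q 0 1 2 0
  have c3 := q 0 1 2 1
  have c4 := q 0 2 1 0
  have c5 := q 0 2 2 0
  have c6 := q 0 2 2 1
  have c7 := q 1 2 1 0
  have c8 := q 1 2 2 0
  have c9 := q 1 2 2 1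
  have c10 := q 0 0 1 0 
  have c11 := q 0 0 2 0
  have c12 := q 0 0 2 1
  have c13 := q 1 1 1 0
  have c14 := q 1 1 2 0
  have c15 := q 1 1 2 1
  have c16 := q 2 2 1 0
  have c17 := q 2 2 2 0
  have c18 := q 2 2 2 1
  simp at c1 c2 c3 c4 c5 c6 c7 c8 c9 c10 c11 c12 c13 c14 c15 c16 c17 c18
  simp only [Fin.sum_univ_three, mm, show (0 : Fin 3) + 1 = 1 from rfl, show (0 : Fin 3) + 2 = 2 from rfl,
    show (1 : Fin 3) + 1 = 2 from rfl, show (1 : Fin 3) + 2 = 0 from rfl,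
    show (2 : Fin 3) + 1 = 0 from rfl, show (2 : Fin 3) + 2 = 1 from rfl]
  simp [dl, h00, h11, h22, h01, h02, h12, c1, c2, c3, c4, c5, c6, c7, c8, c9, c10, c11, c12, c13, c14, c15, c16, c17, c18, GG]
  module
end cas
end
end FT


namespace FT
noncomputable section
variable {m : ℕ}

lemma der_mem (P : Derivation ℂ (AA m) (AA m)) (L : Ideal (AA m)) (h : ∀ g, P (X g) ∈ L) (f : AA m) :
    P f ∈ L := by
  induction f using MvPolynomial.induction_on with
  | C c => 
    have : P (C c) = 0 := P.map_algebraMap c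
    rw [this]; exact L.zero_mem
  | add p q hp hq => rw [map_add]; exact L.add_mem hp hq
  | mul_X p g hp =>
    rw [Derivation.leibniz]
    exact L.add_mem (L.mul_mem_left _ (h g)) (L.mul_mem_left _ hp)

lemma yUU (i j : Fin m) (a : Fin 3) (g : AA m) : yy i j a * UU g - Del i j a * EY g ∈ LL m := by
  have h := der_mem (yy i j a • UU - Del i j a • EY) (LL m) (fun g => by
    rcases g with ⟨i', a'⟩ | ⟨i', j', a'⟩
    · have h1 := UU_xx i' a'
      have h2 := EY_xx i' a'
      simp only [xx] at h1 h2
      simp [h1, h2]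
    · have h1 := UU_yy i' j' a'
      have h2 := EY_yy i' j' a'
      simp only [yy] at h1 h2
      simp only [Derivation.sub_apply, Derivation.smul_apply, h1, h2, smul_eq_mul]
      change yy i j a * Del i' j' a' - Del i j a * yy i' j' a' ∈ LL m
      apply mem11
      · simp only [map_sub, map_mul phi, phi_yy, phi_Del]; ring
      · have e1 : ∀ i j : Fin m, ∀ a, EY (Del i j a) = 0 := by
          intro i j a; simp [Del, cr]
        simp only [map_sub, Derivation.leibniz, e1, EY_yy, smul_eq_mul]; ring) g
  simpa using h

lemma EE_mem (a b : Fin 3) {f : AA m} (hf : f ∈ LL m) : EE a b f ∈ LL m := by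
  refine Submodule.span_induction ?_ ?_ ?_ ?_ hf
  · rintro f (⟨h1, h2⟩ | ⟨h1, h2, k, hk⟩)
    · apply mem11
      · rw [phi_EE, h2, map_zero]
      · have := (Op_EE a b).sy f
        simpa [h1] using this
    · apply memY k
      · rw [phi_EE, h2, map_zero]
      · have := (Op_EE a b).sy f
        simpa [hk] using this
      · have := (Op_EE a b).sx f
        simpa [h1] using this
  · simp
  · intro x y _ _ hx hy; rw [map_add]; exact Ideal.add_mem _ hx hy
  · intro c x hx' hx
    rw [smul_eq_mul, Derivation.leibniz]
    exact Ideal.add_mem _ (Ideal.mul_mem_left _ _ hx) (by rw [smul_eq_mul]; exact Ideal.mul_mem_right _ _ hx')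

lemma dl_comm {ι : Type*} [DecidableEq ι] (a b : ι) : dl a b = dl b a := by
  simp only [dl, eq_comm]

lemma EE_comm (a b c d : Fin 3) (f : AA m) :
    EE a b (EE c d f) = EE c d (EE a b f) + dl b c • EE a d f - dl a d • EE c b f := by
  have : ⁅(EE a b : Derivation ℂ (AA m) (AA m)), (EE c d : Derivation ℂ (AA m) (AA m))⁆ = dl b c • EE a d - dl a d • EE c b := by
    apply der_ext
    · intro i k
      simp only [Derivation.commutator_apply, EE_xx, Derivation.map_smul, Derivation.sub_apply, Derivation.smul_apply]
      rw [dl_comm d a]; module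
    · intro i j k
      simp only [Derivation.commutator_apply, EE_yy, Derivation.map_smul, Derivation.sub_apply, Derivation.smul_apply, map_sub]
      rw [dl_comm c b]; module
  have h := congrArg (fun Q : Derivation ℂ (AA m) (AA m) => Q f) this
  simp only [Derivation.commutator_apply, Derivation.sub_apply, Derivation.smul_apply] at h
  rw [sub_eq_iff_eq_add] at h
  rw [h]; abel

lemma EE_trace (f : AA m) : EE 0 0 f + EE 1 1 f + EE 2 2 f = EY f + NN f := by
  have : (EE 0 0 + EE 1 1 + EE 2 2 : Derivation ℂ (AA m) (AA m)) = EY + NN := by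
    apply der_ext
    · intro i k; fin_cases k <;> simp [dl]
    · intro i j k; fin_cases k <;> simp [dl] <;> abel
  have h := congrArg (fun Q : Derivation ℂ (AA m) (AA m) => Q f) this
  simpa using h

/-- Casimir operator modulo `LL` -/
lemma CC_mem {f : AA m} {w0 w1 w2 n : ℂ} (h00 : EE 0 0 f = w0 • f) (h11 : EE 1 1 f = w1 • f)
    (h22 : EE 2 2 f = w2 • f) (hn : NN f = n • f)
    (h01 : EE 0 1 f ∈ LL m) (h02 : EE 0 2 f ∈ LL m) (h12 : EE 1 2 f ∈ LL m) :
    CC f + GG w0 w1 w2 n • f ∈ LL m := by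
  let L' : Submodule ℂ (AA m) := (LL m).restrictScalars ℂ
  let e : Fin 3 → Fin 3 → Module.End ℂ (AA m ⧸ L') := fun a b =>
    L'.mapQ L' (op (EE a b)) (fun f hf => EE_mem a b hf)
  have he : ∀ a b g, e a b (L'.mkQ g) = L'.mkQ (EE a b g) := fun a b g => rfl
  have h := cas e (by
    intro a b c d v
    obtain ⟨g, rfl⟩ := L'.mkQ_surjective v
    simp only [he, ← map_smul, ← map_add, ← map_sub]
    rw [EE_comm]) (L'.mkQ f) w0 w1 w2 n (by rw [he, h00, map_smul]) (by rw [he, h11, map_smul])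
    (by rw [he, h22, map_smul]) ((Submodule.Quotient.mk_eq_zero _).2 h01)
    ((Submodule.Quotient.mk_eq_zero _).2 h02) ((Submodule.Quotient.mk_eq_zero _).2 h12)
  have hm : ∀ a b (g : AA m), mm e a b (L'.mkQ g) = L'.mkQ (MM a b g) := by
    intro a b g
    simp only [mm, he, ← map_smul, ← map_sub]
    rfl
  simp only [hm, he, ← map_sum, ← map_smul, ← map_sub, ← map_neg] at h
  have h2 : CC f = ∑ a, ∑ b, EE a b (MM a b f) - n • ∑ a, MM a a f := by
    simp only [CC, LinearMap.sub_apply, LinearMap.sum_apply, Module.End.mul_apply, op_apply, hn, map_smul,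
      Finset.smul_sum]
  rw [← h2] at h
  have h3 := (Submodule.Quotient.eq L').1 h
  rw [sub_neg_eq_add] at h3
  exact h3

/-- reduction of the first part of `Dop` -/
lemma F_mem {f : AA m} {k : ℕ} (hk : 1 ≤ k) {n : ℂ} (h0 : phi f = 0) (hy : EY f = ((k + 1 : ℕ) : ℂ) • f)
    (hn : NN f = n • f)
    (ih : ∀ g : AA m, EY g = (k : ℂ) • g → phi g = 0 → g ∈ LL m) (i j : Fin m) (al : Fin 3) :
    yy i j al * F0 al i j f + Del i j al * F1 al i j f ∈ LL m := by
  have hphi : phi (F0 al i j f) + phi (F1 al i j f) = 0 := by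
    rw [phi_F]
    have : phi (NN2 f) = 0 := by
      simp [NN2, hn, h0]
    rw [this, h0]
    simp [cdS, cr]
  have hy0 : EY (F0 al i j f) = (k : ℂ) • F0 al i j f := by
    rw [(Op_F0 al i j).sy, hy, map_smul]; push_cast; module
  have hy1 : EY (F1 al i j f) = ((k : ℂ) + 1) • F1 al i j f := by
    rw [(Op_F1 al i j).sy, hy, map_smul]; push_cast; module
  have hyU : EY (UU (F1 al i j f)) = (k : ℂ) • UU (F1 al i j f) := by
    have := Op_UU.sy (F1 al i j f)
    simp only [op_apply] at this
    rw [this, hy1, Derivation.map_smul]; push_cast; module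
  have hk0 : (k : ℂ) + 1 ≠ 0 := by exact_mod_cast Nat.succ_ne_zero k
  have h1 : F0 al i j f + ((k : ℂ) + 1)⁻¹ • UU (F1 al i j f) ∈ LL m := by
    apply ih
    · rw [map_add, Derivation.map_smul, hy0, hyU]; module
    · rw [map_add, map_smul, phi_UU, hy1, map_smul, smul_smul, inv_mul_cancel₀ hk0, one_smul, hphi]
  have h2 := yUU i j al (F1 al i j f)
  rw [hy1] at h2
  have h3 : (algebraMap ℂ (AA m)) (((k : ℂ) + 1)⁻¹) * (algebraMap ℂ (AA m)) ((k : ℂ) + 1) = 1 := by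
    rw [← map_mul, inv_mul_cancel₀ hk0, map_one]
  have h4 := Ideal.sub_mem _ (Ideal.mul_mem_left _ (yy i j al) h1)
    (Ideal.mul_mem_left _ (algebraMap ℂ (AA m) (((k : ℂ) + 1)⁻¹)) h2)
  convert h4 using 1
  simp only [Algebra.smul_def]
  linear_combination (-Del i j al * F1 al i j f) * h3

lemma CC_mem' {f : AA m} {k : ℕ} (hk : 1 ≤ k) {n : ℂ} (h0 : phi f = 0) (hy : EY f = ((k + 1 : ℕ) : ℂ) • f)
    (hn : NN f = n • f)
    (ih : ∀ g : AA m, EY g = (k : ℂ) • g → phi g = 0 → g ∈ LL m) : CC f ∈ LL m := by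
  have h1 := Dop_mem f
  have h2 : ∑ i, ∑ j, ∑ al, (yy i j al * F0 al i j f + Del i j al * F1 al i j f) ∈ LL m :=
    Ideal.sum_mem _ fun i _ => Ideal.sum_mem _ fun j _ => Ideal.sum_mem _ fun al _ =>
      F_mem hk h0 hy hn ih i j al
  have h3 : Dop f = algebraMap ℂ (AA m) (1 / 2) * (∑ i, ∑ j, ∑ al, (yy i j al * F0 al i j f + Del i j al * F1 al i j f)) - CC f := by
    rw [← Algebra.smul_def, Dop]
    simp only [LinearMap.sub_apply, LinearMap.smul_apply, LinearMap.sum_apply, LinearMap.add_apply,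
      Module.End.mul_apply, mL_apply]
  rw [h3] at h1
  have h4 := Ideal.sub_mem _ (Ideal.mul_mem_left _ (algebraMap ℂ (AA m) (1 / 2)) h2) h1
  rwa [sub_sub_cancel] at h4
end
end FT


namespace FT
noncomputable section
variable {m : ℕ}

def wE (a : Fin 3) : Gn m → ℕ :=
  Sum.elim (fun p => if a = p.2 then 1 else 0) (fun p => if a = p.2.2 then 0 else 1)

lemma EE_X (a : Fin 3) (g : Gn m) : EE a a (X g : AA m) = (wE a g : ℂ) • X g := by
  rcases g with ⟨i, c⟩ | ⟨i, j, c⟩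
  · have h := EE_xx a a c i
    simp only [xx] at h
    rw [h]
    by_cases hc : a = c
    · subst hc; simp [wE, dl]
    · simp [wE, dl, hc]
  · have h := EE_yy a a c i j
    simp only [yy] at h
    rw [h]
    by_cases hc : a = c
    · subst hc; simp [wE, dl]
    · simp [wE, dl, hc]

lemma NN_X (g : Gn m) : NN (X g : AA m) = (((fun _ => 1 : Gn m → ℕ) g : ℕ) : ℂ) • X g := by
  rcases g with ⟨i, c⟩ | ⟨i, j, c⟩
  · have h := NN_xx i c
    simp only [xx] at h
    simp [h]
  · have h := NN_yy i j c
    simp only [yy] at h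
    simp [h]

lemma eig_weight {σ : Type*} {w : σ → ℕ} {P : Derivation ℂ (MvPolynomial σ ℂ) (MvPolynomial σ ℂ)}
    (hP : ∀ g, P (X g) = (w g : ℂ) • X g) {f : MvPolynomial σ ℂ} {z : ℂ} (h : P f = z • f) {s : σ →₀ ℕ}
    (hs : coeff s f ≠ 0) : z = ((Finsupp.weight w s : ℕ) : ℂ) := by
  have h1 := euler w P hP s f
  rw [h, coeff_smul, smul_eq_mul] at h1
  exact mul_right_cancel₀ hs h1

lemma weight_mono {σ : Type*} {w w' : σ → ℕ} (h : ∀ g, w g ≤ w' g) (s : σ →₀ ℕ) :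
    Finsupp.weight w s ≤ Finsupp.weight w' s := by
  rw [Finsupp.weight_apply, Finsupp.weight_apply]
  exact Finset.sum_le_sum fun g _ => Nat.mul_le_mul_left _ (h g)

lemma GG_pos (w0 w1 w2 n : ℤ) (h0 : 0 ≤ w0) (h1 : 0 ≤ w1) (h2 : 0 ≤ w2) (h0' : w0 ≤ n) (h1' : w1 ≤ n)
    (h2' : w2 ≤ n) (hn : 2 ≤ n) (ha : n + 1 ≤ w0 + w1 + w2) (hb : w0 + w1 + w2 ≤ 2 * n) :
    0 < (n + 2) * ((w0 + 1) * w1 + (w0 + 1) * w2 + (w1 + 1) * w2) - 3 * (w0 + 2) * (w1 + 1) * w2 := by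
  obtain ⟨v0, rfl⟩ : ∃ v, n = w0 + v := ⟨n - w0, by ring⟩
  obtain ⟨v1, hv1⟩ : ∃ v, w0 + v0 = w1 + v := ⟨w0 + v0 - w1, by ring⟩
  obtain ⟨v2, hv2⟩ : ∃ v, w0 + v0 = w2 + v := ⟨w0 + v0 - w2, by ring⟩
  have hv0' : 0 ≤ v0 := by linarith
  have hv1' : 0 ≤ v1 := by linarith
  have hv2' : 0 ≤ v2 := by linarith
  generalize hN : w0 + v0 = n at *
  have p1 : 0 ≤ v0 * w1 * v2 := by positivity
  have p2 : 0 ≤ v0 * v1 * w2 := by positivity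
  have p3 : 0 ≤ w0 * w1 * v2 := by positivity
  have p4 : 0 ≤ w0 * v1 * w2 := by positivity
  have p5 : 0 ≤ v0 * w1 * w2 := by positivity
  have hs : 0 < v0 * w1 * v2 + v0 * v1 * w2 + w0 * w1 * v2 + w0 * v1 * w2 + v0 * w1 * w2 := by
    by_contra hc
    have q1 : v0 * w1 * v2 = 0 := by linarith
    have q2 : v0 * v1 * w2 = 0 := by linarith
    have q3 : w0 * w1 * v2 = 0 := by linarith
    have q4 : w0 * v1 * w2 = 0 := by linarith
    have q5 : v0 * w1 * w2 = 0 := by linarith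
    simp only [mul_eq_zero] at q1 q2 q3 q4 q5
    omega
  have c1 : 1 ≤ (n + 2) * n := by nlinarith
  have c2 : 1 ≤ 2 * n ^ 2 - 2 * n := by nlinarith
  have c3 : 1 ≤ (n + 2) * (n + 1) * n := by nlinarith
  have c4 : 1 ≤ (n + 2) * (n ^ 2 - n) := by nlinarith
  have c5 : 1 ≤ n ^ 3 - n ^ 2 := by nlinarith
  have key : n ^ 3 * ((n + 2) * ((w0 + 1) * w1 + (w0 + 1) * w2 + (w1 + 1) * w2) - 3 * (w0 + 2) * (w1 + 1) * w2)
      = (n + 2) * n * (v0 * w1 * v2) + (2 * n ^ 2 - 2 * n) * (v0 * v1 * w2)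
      + (n + 2) * (n + 1) * n * (w0 * w1 * v2) + (n + 2) * (n ^ 2 - n) * (w0 * v1 * w2)
      + (n ^ 3 - n ^ 2) * (v0 * w1 * w2) := by
    obtain rfl : v0 = n - w0 := by linarith
    obtain rfl : v1 = n - w1 := by linarith
    obtain rfl : v2 = n - w2 := by linarith
    ring
  have hpos : 0 < n ^ 3 * ((n + 2) * ((w0 + 1) * w1 + (w0 + 1) * w2 + (w1 + 1) * w2) - 3 * (w0 + 2) * (w1 + 1) * w2) := by
    rw [key]
    have r1 := mul_le_mul_of_nonneg_right c1 p1
    have r2 := mul_le_mul_of_nonneg_right c2 p2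
    have r3 := mul_le_mul_of_nonneg_right c3 p3
    have r4 := mul_le_mul_of_nonneg_right c4 p4
    have r5 := mul_le_mul_of_nonneg_right c5 p5
    linarith
  exact pos_of_mul_pos_right hpos (by positivity)

lemma claimW {k : ℕ} (hk : 1 ≤ k) (ih : ∀ g : AA m, EY g = (k : ℂ) • g → phi g = 0 → g ∈ LL m)
    (M : ℕ) : ∀ w0 w1 w2 : ℤ, w0 + 2 * w1 + 3 * w2 < M → ∀ f : AA m, EY f = ((k + 1 : ℕ) : ℂ) • f →
    phi f = 0 → EE 0 0 f = (w0 : ℂ) • f → EE 1 1 f = (w1 : ℂ) • f → EE 2 2 f = (w2 : ℂ) • f →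
    f ∈ LL m := by
  induction M with
  | zero =>
    intro w0 w1 w2 hw f hy h0 h00 h11 h22
    by_contra hf
    have hf0 : f ≠ 0 := fun h => hf (h ▸ Ideal.zero_mem _)
    obtain ⟨s, hs⟩ := MvPolynomial.ne_zero_iff.1 hf0
    have e0 := eig_weight (EE_X 0) h00 hs
    have e1 := eig_weight (EE_X 1) h11 hs
    have e2 := eig_weight (EE_X 2) h22 hs
    norm_cast at e0 e1 e2
    omega
  | succ M ihM =>
    intro w0 w1 w2 hw f hy h0 h00 h11 h22
    by_cases hf0 : f = 0
    · rw [hf0]; exact Ideal.zero_mem _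
    obtain ⟨s, hs⟩ := MvPolynomial.ne_zero_iff.1 hf0
    have hn : NN f = ((w0 + w1 + w2 - (k + 1) : ℤ) : ℂ) • f := by
      have := EE_trace f
      rw [h00, h11, h22, hy] at this
      rw [← sub_eq_iff_eq_add'] at this
      rw [← this]; push_cast; module
    have e0 := eig_weight (EE_X 0) h00 hs
    have e1 := eig_weight (EE_X 1) h11 hs
    have e2 := eig_weight (EE_X 2) h22 hs
    have en := eig_weight NN_X hn hs
    have ey := eig_weight EY_X hy hs
    have l0 := weight_mono (w := wE 0) (w' := fun _ : Gn m => 1) (fun g => by rcases g with g | g <;> simp [wE] <;> split_ifs <;> simp) s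
    have l1 := weight_mono (w := wE 1) (w' := fun _ : Gn m => 1) (fun g => by rcases g with g | g <;> simp [wE] <;> split_ifs <;> simp) s
    have l2 := weight_mono (w := wE 2) (w' := fun _ : Gn m => 1) (fun g => by rcases g with g | g <;> simp [wE] <;> split_ifs <;> simp) s
    have ly := weight_mono (w := wY) (w' := fun _ : Gn m => 1) (fun g => by rcases g with g | g <;> simp [wY]) s
    norm_cast at e0 e1 e2 en ey
    have hE : ∀ a b, EY (EE a b f) = ((k + 1 : ℕ) : ℂ) • EE a b f ∧ phi (EE a b f) = 0 := by
      intro a b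
      constructor
      · have := (Op_EE a b).sy f
        simpa [hy] using this
      · rw [phi_EE, h0, map_zero]
    have h01 : EE 0 1 f ∈ LL m := by
      refine ihM (w0 + 1) (w1 - 1) w2 (by push_cast at hw; omega) _ (hE 0 1).1 (hE 0 1).2 ?_ ?_ ?_ <;> rw [EE_comm] <;>
        simp only [h00, h11, h22, Derivation.map_smul] <;> simp [dl] <;> module
    have h02 : EE 0 2 f ∈ LL m := by
      refine ihM (w0 + 1) w1 (w2 - 1) (by push_cast at hw; omega) _ (hE 0 2).1 (hE 0 2).2 ?_ ?_ ?_ <;> rw [EE_comm] <;>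
        simp only [h00, h11, h22, Derivation.map_smul] <;> simp [dl] <;> module
    have h12 : EE 1 2 f ∈ LL m := by
      refine ihM w0 (w1 + 1) (w2 - 1) (by push_cast at hw; omega) _ (hE 1 2).1 (hE 1 2).2 ?_ ?_ ?_ <;> rw [EE_comm] <;>
        simp only [h00, h11, h22, Derivation.map_smul] <;> simp [dl] <;> module
    have hC := CC_mem h00 h11 h22 hn h01 h02 h12
    have hC' := CC_mem' hk h0 hy hn ih
    have hG := Ideal.sub_mem _ hC hC'
    rw [add_sub_cancel_left] at hG
    have hpos := GG_pos w0 w1 w2 (w0 + w1 + w2 - (k + 1)) (by omega) (by omega) (by omega) (by omega)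
      (by omega) (by omega) (by omega) (by omega) (by omega)
    have hne : GG w0 w1 w2 ((w0 + w1 + w2 - (k + 1) : ℤ) : ℂ) ≠ 0 := by
      rw [GG]
      exact_mod_cast hpos.ne'
    have := Ideal.mul_mem_left _ (algebraMap ℂ (AA m) (GG w0 w1 w2 ((w0 + w1 + w2 - (k + 1) : ℤ) : ℂ))⁻¹) hG
    rwa [← Algebra.smul_def, smul_smul, inv_mul_cancel₀ hne, one_smul] at this

/-! ### decomposition into weight vectors -/

def w3 (g : Gn m) : Fin 3 → ℕ := fun a => wE a g

lemma weight_w3 {σ : Type*} (w : σ → Fin 3 → ℕ) (s : σ →₀ ℕ) (a : Fin 3) :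
    Finsupp.weight w s a = Finsupp.weight (fun g => w g a) s := by
  simp [Finsupp.weight_apply, Finsupp.sum]

lemma coeff_comp (f : AA m) (n : Fin 3 → ℕ) (s) :
    coeff s (weightedHomogeneousComponent w3 n f) = if Finsupp.weight w3 s = n then coeff s f else 0 := by
  classical
  rw [coeff_weightedHomogeneousComponent]

lemma comp_eig (f : AA m) (n : Fin 3 → ℕ) (a : Fin 3) :
    EE a a (weightedHomogeneousComponent w3 n f) = (n a : ℂ) • weightedHomogeneousComponent w3 n f := by
  ext s
  rw [euler (wE a) _ (EE_X a), coeff_smul, coeff_comp]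
  split_ifs with h
  · rw [← h, weight_w3]; rfl
  · simp

lemma comp_EY {f : AA m} {z : ℂ} (h : EY f = z • f) (n : Fin 3 → ℕ) :
    EY (weightedHomogeneousComponent w3 n f) = z • weightedHomogeneousComponent w3 n f := by
  ext s
  rw [euler wY _ EY_X, coeff_smul, coeff_comp]
  split_ifs with hs
  · rw [← euler wY _ EY_X, h, coeff_smul]
  · simp

lemma comp_sum (f : AA m) : f = ∑ n ∈ f.support.image (Finsupp.weight w3),
    weightedHomogeneousComponent w3 n f := by
  classical
  ext s
  rw [coeff_sum]
  simp only [coeff_comp, Finset.sum_ite_eq]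
  split_ifs with h
  · rfl
  · by_contra hs
    exact h (Finset.mem_image_of_mem _ (mem_support_iff.2 hs))

def wSS (a : Fin 3) (p : Fin m × Fin 3) : ℕ := if a = p.2 then 1 else 0
lemma ES_X (a : Fin 3) (p : Fin m × Fin 3) : ES a a (X p : SS m) = (wSS a p : ℂ) • X p := by
  obtain ⟨i, c⟩ := p
  have := ES_sx a a c i
  simp only [sx] at this
  rw [this]
  by_cases hc : a = c
  · subst hc; simp [wSS, dl]
  · simp [wSS, dl, hc]

lemma comp_phi {f : AA m} (h : phi f = 0) (n : Fin 3 → ℕ) :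
    phi (weightedHomogeneousComponent w3 n f) = 0 := by
  classical
  have hh : ∀ n' t, coeff t (phi (weightedHomogeneousComponent w3 n' f)) ≠ 0 →
      n' = fun a => Finsupp.weight (wSS a) t := by
    intro n' t ht
    funext a
    have h1 : ES a a (phi (weightedHomogeneousComponent w3 n' f)) = (n' a : ℂ) • phi (weightedHomogeneousComponent w3 n' f) := by
      rw [← phi_EE, comp_eig, map_smul]
    have := eig_weight (ES_X a) h1 ht
    exact_mod_cast this
  by_contra hne
  obtain ⟨t, ht⟩ := MvPolynomial.ne_zero_iff.1 hne
  have h1 := hh n t ht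
  have hmem : n ∈ f.support.image (Finsupp.weight w3) := by
    by_contra hn
    apply hne
    have : weightedHomogeneousComponent w3 n f = 0 := by
      ext s
      rw [coeff_comp, coeff_zero]
      split_ifs with hs
      · by_contra hs'
        exact hn (hs ▸ Finset.mem_image_of_mem _ (mem_support_iff.2 hs'))
      · rfl
    rw [this, map_zero]
  have h2 : coeff t (phi f) = coeff t (phi (weightedHomogeneousComponent w3 n f)) := by
    conv_lhs => rw [comp_sum f, map_sum, coeff_sum]
    apply Finset.sum_eq_single_of_mem _ hmem
    intro n' _ hn'
    by_contra hc
    exact hn' ((hh n' t hc).trans h1.symm)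
  rw [h, coeff_zero] at h2
  exact ht h2.symm

theorem claim (k : ℕ) : ∀ f : AA m, EY f = (k : ℂ) • f → phi f = 0 → f ∈ LL m := by
  induction k with
  | zero =>
    intro f hy h0
    rw [eq_zero_of_EY (by simpa using hy) h0]; exact Ideal.zero_mem _
  | succ k ih =>
    intro f hy h0
    rcases Nat.eq_zero_or_pos k with rfl | hk
    · exact mem11 h0 (by simpa using hy)
    · rw [comp_sum f]
      refine Ideal.sum_mem _ fun n _ => ?_
      exact claimW hk ih (n 0 + 2 * n 1 + 3 * n 2 + 1) (n 0) (n 1) (n 2) (by push_cast; omega) _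
        (comp_EY hy n) (comp_phi h0 n) (by simpa using comp_eig f n 0) (by simpa using comp_eig f n 1)
        (by simpa using comp_eig f n 2)
end
end FT

namespace FT
noncomputable section
variable {m : ℕ}

/-! ### transfer to the Rees presentation -/

abbrev RT (m : ℕ) : Type := MvPolynomial (MinorIdx m 3) (SS m)

/-- columns of the minor complementary to `c` -/
def cp1 : Fin 3 → Fin 3 := ![1, 0, 0]
def cp2 : Fin 3 → Fin 3 := ![2, 2, 1]
def cs : Fin 3 → ℂ := ![1, -1, 1]
lemma cp_lt : ∀ c, cp1 c < cp2 c := by decide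

def wi (i j : Fin m) (h : i < j) (c : Fin 3) : MinorIdx m 3 := ⟨((i, j), (cp1 c, cp2 c)), h, cp_lt c⟩

/-- the image of the generator `y_ij^c` over any base ring -/
def yT (R : Type*) [CommRing R] [Algebra ℂ R] (i j : Fin m) (c : Fin 3) : MvPolynomial (MinorIdx m 3) R :=
  if h : i < j then C (algebraMap ℂ R (cs c)) * X (wi i j h c)
  else if h : j < i then C (algebraMap ℂ R (-cs c)) * X (wi j i h c) else 0

lemma yT_hom (R : Type*) [CommRing R] [Algebra ℂ R] (i j : Fin m) (c : Fin 3) :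
    (yT R i j c).IsHomogeneous 1 := by
  rw [yT]
  split_ifs with h h'
  · simpa using (isHomogeneous_C _ _).mul (isHomogeneous_X R (wi i j h c))
  · simpa using (isHomogeneous_C _ (algebraMap ℂ R (-cs c))).mul (isHomogeneous_X R (wi j i h' c))
  · exact isHomogeneous_zero _ _ _

lemma map_yT (i j : Fin m) (c : Fin 3) :
    MvPolynomial.map (algebraMap ℂ (SS m)) (yT ℂ i j c) = yT (SS m) i j c := by
  rw [yT, yT]
  split_ifs with h h'
  · simp
  · simp
  · simp

def rhoX : Gn m → RT m := Sum.elim (fun p => C (X p)) (fun p => yT (SS m) p.1 p.2.1 p.2.2)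
def rho : AA m →ₐ[ℂ] RT m := aeval rhoX

@[simp] lemma rho_X (g : Gn m) : rho (X g) = rhoX g := by simp [rho]

lemma rhoX_hom (g : Gn m) : (rhoX g).IsHomogeneous (wY g) := by
  rcases g with p | p
  · exact isHomogeneous_C _ _
  · exact yT_hom _ _ _ _

lemma minor_wi (i j : Fin m) (h : i < j) (c : Fin 3) :
    C (cs c) * minorΔ (wi i j h c) = cr (sx i) (sx j) c := by
  fin_cases c <;> simp [cs, wi, minorΔ, cr, sx, cp1, cp2]

lemma Pi_rhoX (g : Gn m) : Pihom m 3 (rhoX g) = Polynomial.C (phi (X g)) * Polynomial.X ^ (wY g) := by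
  rcases g with ⟨i, c⟩ | ⟨i, j, c⟩
  · have := phi_xx (m := m) i c
    simp only [xx] at this
    simp [rhoX, wY, this, sx, Pihom]
  · have := phi_yy (m := m) i j c
    simp only [yy] at this
    rw [this]
    simp only [rhoX, wY, Sum.elim_inr, yT, pow_one]
    split_ifs with h h'
    · rw [← minor_wi i j h c]
      simp [Pihom, mul_assoc]
    · have : cr (sx i) (sx j) c = C (-cs c) * minorΔ (wi j i h' c) := by
        rw [C_neg, neg_mul, minor_wi j i h' c]
        simp only [cr]; ring
      rw [this]
      simp [Pihom]
      ring
    · obtain rfl : i = j := le_antisymm (not_lt.1 h') (not_lt.1 h)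
      have : cr (sx i) (sx i) c = 0 := by simp only [cr]; ring
      simp [this]

lemma weight_of {w : Gn m → ℕ} {P : Derivation ℂ (AA m) (AA m)} (hP : ∀ g, P (X g) = (w g : ℂ) • X g)
    {f : AA m} {k : ℕ} (h : P f = (k : ℂ) • f) {s : Gn m →₀ ℕ} (hs : s ∈ f.support) :
    s.sum (fun g e => e * w g) = k := by
  have := eig_weight hP h (mem_support_iff.1 hs)
  rw [Finsupp.weight_apply] at this
  exact_mod_cast this.symm

lemma rho_hom {f : AA m} {k : ℕ} (h : EY f = (k : ℂ) • f) : (rho f).IsHomogeneous k := by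
  rw [f.as_sum, map_sum]
  refine IsHomogeneous.sum _ _ _ fun s hs => ?_
  have hk := weight_of EY_X h hs
  rw [rho, aeval_monomial, ← zero_add k]
  refine IsHomogeneous.mul (isHomogeneous_C _ _) ?_
  rw [← hk]
  refine IsHomogeneous.prod _ _ _ fun g _ => ?_
  have := (rhoX_hom g).pow (s g)
  rwa [mul_comm] at this

lemma mono_gen {R : Type*} [CommRing R] [Algebra ℂ R] (F : AA m →ₐ[ℂ] Polynomial R) (p : AA m →ₐ[ℂ] R)
    (h : ∀ g, F (X g) = Polynomial.C (p (X g)) * Polynomial.X ^ (wY g)) (s : Gn m →₀ ℕ) (c : ℂ) :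
    F (monomial s c) = Polynomial.C (p (monomial s c)) * Polynomial.X ^ (s.sum (fun g e => e * wY g)) := by
  have e : (monomial s c : AA m) = algebraMap ℂ (AA m) c * s.prod (fun g e => X g ^ e) := monomial_eq
  rw [e, map_mul, map_mul, AlgHom.commutes, AlgHom.commutes, Polynomial.C_mul, mul_assoc]
  congr 1
  rw [Finsupp.prod, map_prod, map_prod, map_prod, Finsupp.sum, ← Finset.prod_pow_eq_pow_sum,
    ← Finset.prod_mul_distrib]
  refine Finset.prod_congr rfl fun g _ => ?_
  rw [map_pow, map_pow, map_pow, h, mul_pow, ← pow_mul, mul_comm (wY g)]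

def Pr : AA m →ₐ[ℂ] Polynomial (SS m) := ((Pihom m 3).restrictScalars ℂ).comp rho

lemma Pi_rho {f : AA m} {k : ℕ} (h : EY f = (k : ℂ) • f) :
    Pihom m 3 (rho f) = Polynomial.C (phi f) * Polynomial.X ^ k := by
  have h0 : ∀ g : Gn m, Pr (X g) = Polynomial.C (phi (X g)) * Polynomial.X ^ (wY g) := by
    intro g
    rw [← Pi_rhoX, ← rho_X]
    rfl
  have h1 : Pr f = Polynomial.C (phi f) * Polynomial.X ^ k := by
    conv_lhs => rw [f.as_sum]
    conv_rhs => rw [f.as_sum]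
    rw [map_sum, map_sum, map_sum, Finset.sum_mul]
    refine Finset.sum_congr rfl fun s hs => ?_
    rw [mono_gen Pr phi h0, weight_of EY_X h hs]
  exact h1

/-- the section `T → A` -/
def sigX (w : MinorIdx m 3) : AA m :=
  if w.1.2.1 = 1 then yy w.1.1.1 w.1.1.2 0 else if w.1.2.2 = 2 then - yy w.1.1.1 w.1.1.2 1
    else yy w.1.1.1 w.1.1.2 2
def sig : RT m →+* AA m := eval₂Hom (rename (Sum.inl : Fin m × Fin 3 → Gn m)).toRingHom sigX

lemma rho_sigX (w : MinorIdx m 3) : rho (sigX w) = X w := by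
  obtain ⟨⟨⟨i, j⟩, a, b⟩, h, h'⟩ := w
  simp only at h h'
  have e : ∀ c, rho (yy i j c) = C (C (cs c)) * X (wi i j h c) := by
    intro c
    simp only [yy, rho_X, rhoX, Sum.elim_inr, yT, dif_pos h]
    rfl
  simp only [sigX]
  split_ifs with h1 h2
  · subst h1
    obtain rfl : b = 2 := by omega
    rw [e]; simp [cs]; rfl
  · subst h2
    obtain rfl : a = 0 := by omega
    rw [map_neg, e]
    have h3 : (C (C (cs 1)) : RT m) = -1 := by simp [cs]
    have h4 : ∀ z : RT m, -(-1 * z) = z := fun z => by ring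
    rw [h3]
    exact h4 _
  · obtain rfl : b = 1 := by omega
    obtain rfl : a = 0 := by omega
    rw [e]; simp [cs]; rfl

lemma rho_sig (f : RT m) : rho (sig f) = f := by
  have : (rho : AA m →ₐ[ℂ] RT m).toRingHom.comp sig = RingHom.id _ := by
    apply MvPolynomial.ringHom_ext
    · intro p
      have h : ((rho : AA m →ₐ[ℂ] RT m).comp (rename (Sum.inl : Fin m × Fin 3 → Gn m))) =
          IsScalarTower.toAlgHom ℂ (SS m) (RT m) := by
        apply MvPolynomial.algHom_ext
        intro p
        simp [rhoX, algebraMap_eq]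
      have h2 := DFunLike.congr_fun h p
      simpa [sig, algebraMap_eq] using h2
    · intro w
      simp [sig, rho_sigX]
  exact DFunLike.congr_fun this f

lemma rho_range {f : AA m} (h : EX f = 0) :
    rho f ∈ Set.range (MvPolynomial.map (algebraMap ℂ (SS m)) (σ := MinorIdx m 3)) := by
  have hv : ∀ g ∈ f.vars, wX g = 0 := by
    intro g hg
    obtain ⟨s, hs, hgs⟩ := (mem_vars g).1 hg
    have h3 := weight_of (k := 0) EX_X (by simpa using h) hs
    have := (Finset.sum_eq_zero_iff.1 h3) g hgs
    exact (mul_eq_zero.1 this).resolve_left (Finsupp.mem_support_iff.1 hgs)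
  let r : AA m →ₐ[ℂ] MvPolynomial (MinorIdx m 3) ℂ :=
    aeval (Sum.elim (fun _ => 0) (fun p => yT ℂ p.1 p.2.1 p.2.2))
  refine ⟨r f, ?_⟩
  have := MvPolynomial.hom_congr_vars
    (f₁ := (MvPolynomial.map (algebraMap ℂ (SS m)) (σ := MinorIdx m 3)).comp r.toRingHom)
    (f₂ := (rho : AA m →ₐ[ℂ] RT m).toRingHom) (p₁ := f) (p₂ := f) ?_ ?_ rfl
  · exact this
  · ext1 c
    have h1 : (C c : AA m) = algebraMap ℂ _ c := rfl
    simp only [RingHom.comp_apply, AlgHom.toRingHom_eq_coe, RingHom.coe_coe, h1, AlgHom.commutes]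
    have h2 : (algebraMap ℂ (RT m) c) = C (algebraMap ℂ (SS m) c) := rfl
    rw [h2]
    simp
  · intro g hg _
    have := hv g hg
    rcases g with p | p
    · simp [wX] at this
    · have h6 := map_yT (m := m) p.1 p.2.1 p.2.2
      simpa [r, rhoX] using h6

lemma compY_eig (f : AA m) (n : ℕ) :
    EY (weightedHomogeneousComponent wY n f) = (n : ℂ) • weightedHomogeneousComponent wY n f := by
  classical
  ext s
  rw [euler wY _ EY_X, coeff_smul, coeff_weightedHomogeneousComponent]
  split_ifs with h
  · rw [← h]; rfl
  · simp

lemma compY_sum (f : AA m) : f = ∑ n ∈ f.support.image (Finsupp.weight wY),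
    weightedHomogeneousComponent wY n f := by
  classical
  ext s
  rw [coeff_sum]
  simp only [coeff_weightedHomogeneousComponent, Finset.sum_ite_eq]
  split_ifs with h
  · rfl
  · by_contra hs
    exact h (Finset.mem_image_of_mem _ (mem_support_iff.2 hs))

lemma phi_comp {f : AA m} (h : Pihom m 3 (rho f) = 0) (n : ℕ) :
    phi (weightedHomogeneousComponent wY n f) = 0 := by
  classical
  rw [compY_sum f, map_sum, map_sum] at h
  simp only [Pi_rho (compY_eig f _)] at h
  have h1 := congrArg (fun p => Polynomial.coeff p n) h
  simp only [Polynomial.finset_sum_coeff, Polynomial.coeff_C_mul, Polynomial.coeff_X_pow, mul_ite, mul_one,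
    mul_zero, Finset.sum_ite_eq, Polynomial.coeff_zero] at h1
  by_cases hn : n ∈ f.support.image (Finsupp.weight wY)
  · rwa [if_pos hn] at h1
  · have : weightedHomogeneousComponent wY n f = 0 := by
      ext s
      rw [coeff_weightedHomogeneousComponent]
      split_ifs with hs
      · by_contra h0
        exact hn (hs ▸ Finset.mem_image_of_mem _ (mem_support_iff.2 h0))
      · simp
    rw [this, map_zero]

theorem fiberType (m : ℕ) : FiberType m 3 := by
  rw [FiberType]
  apply le_antisymm
  · intro f hf
    rw [RingHom.mem_ker] at hf
    rw [← rho_sig f] at hf ⊢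
    have hmem : sig f ∈ LL m := by
      rw [compY_sum (sig f)]
      exact Ideal.sum_mem _ fun n _ => claim n _ (compY_eig _ n) (phi_comp hf n)
    have h2 := Ideal.mem_map_of_mem (rho : AA m →ₐ[ℂ] RT m) hmem
    rw [LL, Ideal.map_span] at h2
    refine Ideal.span_mono ?_ h2
    rintro _ ⟨g, hg | hg, rfl⟩
    · obtain ⟨h3, h4⟩ := hg
      have h5 : EY g = ((1 : ℕ) : ℂ) • g := by simpa using h3
      right
      exact ⟨by rw [RingHom.mem_ker, Pi_rho h5, h4]; simp, rho_hom h5⟩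
    · obtain ⟨h3, h4, k, h5⟩ := hg
      left
      exact ⟨by rw [RingHom.mem_ker, Pi_rho h5, h4]; simp, rho_range h3⟩
  · rw [Ideal.span_le]
    rintro f (hf | hf)
    · exact hf.1
    · exact hf.1

end
end FT

/-- For every `m ≥ 3`, the ideal of 2×2 minors of the generic `m × 3` matrix is
of fiber type. -/
theorem fiber_type_m_by_three (m : ℕ) (hm : 3 ≤ m) : FiberType m 3 := by
  exact FT.fiberType m
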